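/- arXiv:1107.0552 — 5 statements merged into one kernel-verified Lean document; each statement's English description precedes it below -/
import Mathlib

section
/- Let A and B be unital complex C*-algebras and let ι : A → B be an isometric unital *-homomorphism. Let Φ : A → A and Ψ : B → B be completely positive bounded linear maps with ‖Φ‖ < 1 (so that id_A − Φ is an invertible bounded operator on A, and likewise id − Φ⁽ᵏ⁾ is invertible on each matrix level since ‖Φ⁽ᵏ⁾‖ = ‖Φ(1)‖ ≤ ‖Φ‖ < 1). Then the Pick operator P := (id_B − Ψ) ∘ ι ∘ (id_A − Φ)⁻¹ : A → B is completely positive if and only if Ψ completely dominates Φ in the sense of Lyapunov. -/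
/-!
STATEMENT 0: Let A and B be unital complex C*-algebras and let ι : A → B be an isometric
unital *-homomorphism.  Let Φ : A → A and Ψ : B → B be completely positive bounded linear
maps with ‖Φ‖ < 1 (so that id_A − Φ is invertible).  Then the Pick operator
P := (id_B − Ψ) ∘ ι ∘ (id_A − Φ)⁻¹ : A → B is completely positive if and only if Ψ completely
dominates Φ in the sense of Lyapunov.

Matrix levels are realized with `Matrix (Fin k) (Fin k) A` (the C*-algebra of k×k matrices
over A), positivity of an element of a matrix C*-algebra is expressed by the C*-algebraic
characterization `∃ b, a = star b * b`, and `a ≤ b` by `∃ c, b - a = star c * c`.  The inverse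
`(id_A − Φ)⁻¹` is the inverse of the unit `Units.oneSub Φ h` (whose value is `1 - Φ`) in the
Banach algebra `A →L[ℂ] A`.  Convergence `Φⁿ(a) → 0` in norm in the matrix C*-algebra is
expressed entrywise (which is equivalent, the matrices being finite).
-/

open Filter

/-- The entrywise amplification of a map to `k × k` matrices. -/
def ampl {A B : Type*} (k : ℕ) (f : A → B) (a : Matrix (Fin k) (Fin k) A) :
    Matrix (Fin k) (Fin k) B :=
  Matrix.of fun i j => f (a i j)

/-- Nonnegativity in a C*-algebra (in particular in a matrix algebra over a C*-algebra),
via the characterization of the positive cone as `{star b * b}`. -/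
def StarNonneg {A : Type*} [Mul A] [Star A] (a : A) : Prop :=
  ∃ b, a = star b * b

/-- The C*-order: `a ≤ b` iff `b - a` is nonnegative. -/
def StarLE {A : Type*} [Mul A] [Star A] [Sub A] (a b : A) : Prop :=
  StarNonneg (b - a)

/-- A map between C*-algebras is completely positive if all of its matrix amplifications map
nonnegative elements to nonnegative elements. -/
def CompletelyPositive {A B : Type*} [NonUnitalNonAssocSemiring A] [Star A]
    [NonUnitalNonAssocSemiring B] [Star B] (f : A → B) : Prop :=
  ∀ k : ℕ, 1 ≤ k → ∀ a : Matrix (Fin k) (Fin k) A,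
    StarNonneg a → StarNonneg (ampl k f a)

/-- `a` is superharmonic for `Φ` if `0 ≤ a` and `Φ a ≤ a`. -/
def Superharmonic {A : Type*} [NonUnitalNonAssocRing A] [Star A] (Φ : A → A) (a : A) : Prop :=
  StarNonneg a ∧ StarLE (Φ a) a

/-- `a` is pure superharmonic for `Φ` if it is superharmonic and the iterates `Φⁿ(a)` tend to
`0` in norm (expressed entrywise for matrices over a normed algebra, which is equivalent). -/
def PureSuperharmonic {A : Type*} [NormedRing A] [StarRing A] {k : ℕ}
    (Φ : Matrix (Fin k) (Fin k) A → Matrix (Fin k) (Fin k) A)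
    (a : Matrix (Fin k) (Fin k) A) : Prop :=
  Superharmonic Φ a ∧ ∀ i j, Tendsto (fun N : ℕ => (Φ^[N] a) i j) atTop (nhds 0)

/-- `Ψ` completely dominates `Φ` in the sense of Lyapunov (relative to the embedding `ι`):
for every `k ≥ 1`, every pure superharmonic element of `Mₖ(A)` for `Φ⁽ᵏ⁾` is mapped by
`ι⁽ᵏ⁾` to a superharmonic element for `Ψ⁽ᵏ⁾`. -/
def CompletelyLyapunovDominates {A B : Type*} [NormedRing A] [StarRing A]
    [NormedRing B] [StarRing B] (Φ : A → A) (Ψ : B → B) (ι : A → B) : Prop :=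
  ∀ k : ℕ, 1 ≤ k → ∀ a : Matrix (Fin k) (Fin k) A,
    PureSuperharmonic (ampl k Φ) a → Superharmonic (ampl k Ψ) (ampl k ι a)

lemma starNonneg_iff_nonneg {A : Type*} [NonUnitalCStarAlgebra A] [PartialOrder A]
    [StarOrderedRing A] (a : A) : StarNonneg a ↔ 0 ≤ a :=
  CStarAlgebra.nonneg_iff_eq_star_mul_self.symm

lemma starNonneg_matrix_iff {A : Type*} [CStarAlgebra A] {k : ℕ}
    (a : Matrix (Fin k) (Fin k) A) :
    letI := CStarAlgebra.spectralOrder A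
    letI := CStarAlgebra.spectralOrderedRing A
    StarNonneg a ↔ 0 ≤ CStarMatrix.ofMatrix a := by
  let _ := CStarAlgebra.spectralOrder A
  let _ := CStarAlgebra.spectralOrderedRing A
  exact starNonneg_iff_nonneg (CStarMatrix.ofMatrix a)

lemma StarNonneg.add {A : Type*} [CStarAlgebra A] {k : ℕ} {a b : Matrix (Fin k) (Fin k) A}
    (ha : StarNonneg a) (hb : StarNonneg b) : StarNonneg (a + b) := by
  let _ := CStarAlgebra.spectralOrder A
  let _ := CStarAlgebra.spectralOrderedRing A
  rw [starNonneg_matrix_iff] at ha hb ⊢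
  exact add_nonneg ha hb

lemma StarNonneg.zero {A : Type*} [NonUnitalNonAssocSemiring A] [Star A] :
    StarNonneg (0 : A) :=
  ⟨0, (mul_zero _).symm⟩

lemma isClosed_setOf_starNonneg {A : Type*} [CStarAlgebra A] (k : ℕ) :
    IsClosed {a : Matrix (Fin k) (Fin k) A | StarNonneg a} := by
  let _ := CStarAlgebra.spectralOrder A
  let _ := CStarAlgebra.spectralOrderedRing A
  simp only [starNonneg_matrix_iff]
  exact isClosed_Ici (a := (0 : CStarMatrix (Fin k) (Fin k) A)).preimage
    CStarMatrix.uniformEmbedding_ofMatrix.uniformContinuous.continuous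

lemma StarNonneg.hasSum {A : Type*} [CStarAlgebra A] {k : ℕ}
    {f : ℕ → Matrix (Fin k) (Fin k) A} {a : Matrix (Fin k) (Fin k) A}
    (hf : ∀ n, StarNonneg (f n)) (ha : HasSum f a) : StarNonneg a :=
  (isClosed_setOf_starNonneg k).mem_of_tendsto ha <| .of_forall fun _ =>
    Finset.sum_induction f StarNonneg (fun _ _ => StarNonneg.add) StarNonneg.zero fun n _ => hf n

lemma StarNonneg.ampl_starAlgHom {A B : Type*} [CStarAlgebra A] [CStarAlgebra B]
    (ι : A →⋆ₐ[ℂ] B) {k : ℕ} {a : Matrix (Fin k) (Fin k) A} (ha : StarNonneg a) :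
    StarNonneg (ampl k ι a) := by
  obtain ⟨b, rfl⟩ := ha
  refine ⟨ampl k ι b, ?_⟩
  ext i j
  simp [ampl, Matrix.mul_apply, Matrix.star_apply, map_star]

lemma ampl_iterate {A : Type*} [NormedAddCommGroup A] [NormedSpace ℂ A] (Φ : A →L[ℂ] A)
    {k : ℕ} (n : ℕ) (a : Matrix (Fin k) (Fin k) A) :
    (ampl k Φ)^[n] a = ampl k (Φ ^ n : A →L[ℂ] A) a := by
  induction n with
  | zero => rfl
  | succ n ih => rw [Function.iterate_succ_apply', ih, pow_succ']; rfl

lemma CompletelyPositive.iterate {A : Type*} [CStarAlgebra A] {Φ : A → A}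
    (hΦ : CompletelyPositive Φ) {k : ℕ} (hk : 1 ≤ k) {a : Matrix (Fin k) (Fin k) A}
    (ha : StarNonneg a) (n : ℕ) : StarNonneg ((ampl k Φ)^[n] a) := by
  induction n with
  | zero => exact ha
  | succ n ih => rw [Function.iterate_succ_apply']; exact hΦ k hk _ ih

theorem pick_operator_completelyPositive_iff_complete_lyapunov_domination
    {A B : Type*} [CStarAlgebra A] [CStarAlgebra B]
    (ι : A →⋆ₐ[ℂ] B) (hι : Isometry ι)
    (Φ : A →L[ℂ] A) (Ψ : B →L[ℂ] B)
    (hΦcp : CompletelyPositive (⇑Φ)) (hΨcp : CompletelyPositive (⇑Ψ))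
    (hΦ : ‖Φ‖ < 1) :
    CompletelyPositive
        (fun a : A =>
          ι ((((Units.oneSub Φ hΦ)⁻¹ : (A →L[ℂ] A)ˣ) : A →L[ℂ] A) a) -
            Ψ (ι ((((Units.oneSub Φ hΦ)⁻¹ : (A →L[ℂ] A)ˣ) : A →L[ℂ] A) a))) ↔
      CompletelyLyapunovDominates (⇑Φ) (⇑Ψ) (⇑ι) := by
  set R : A →L[ℂ] A := (((Units.oneSub Φ hΦ)⁻¹ : (A →L[ℂ] A)ˣ) : A →L[ℂ] A)
  have right_inv (a : A) : R a - Φ (R a) = a :=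
    DFunLike.congr_fun (Units.oneSub Φ hΦ).mul_inv a
  have left_inv (a : A) : R (a - Φ a) = a :=
    DFunLike.congr_fun (Units.oneSub Φ hΦ).inv_mul a
  have R_hasSum (a : A) : HasSum (fun n : ℕ => (Φ ^ n) a) (R a) :=
    (summable_geometric_of_norm_lt_one hΦ).hasSum.mapL (ContinuousLinearMap.apply ℂ A a)
  constructor
  · rintro hP k hk a ⟨⟨ha, hsuper⟩, -⟩
    refine ⟨ha.ampl_starAlgHom ι, ?_⟩
    obtain ⟨c, hc⟩ := hP k hk _ hsuper
    refine ⟨c, Eq.trans ?_ hc⟩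
    ext i j
    simp only [ampl, Matrix.of_apply, Matrix.sub_apply, left_inv]
  · intro hdom k hk b hb
    have hRb : StarNonneg (ampl k R b) := by
      refine StarNonneg.hasSum (hΦcp.iterate hk hb) ?_
      refine Pi.hasSum.2 fun i => Pi.hasSum.2 fun j => ?_
      simp only [ampl_iterate]
      exact R_hasSum (b i j)
    have hpure : PureSuperharmonic (ampl k Φ) (ampl k R b) := by
      refine ⟨⟨hRb, ?_⟩, fun i j => ?_⟩
      · have hdiff : ampl k R b - ampl k Φ (ampl k R b) = b := by
          ext i j
          exact right_inv (b i j)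
        rwa [StarLE, hdiff]
      · simp only [ampl_iterate]
        exact (R_hasSum _).summable.tendsto_atTop_zero
    exact (hdom k hk _ hpure).2
end

section
/- Let A and B be unital complex C*-algebras and let ι : A → B be an isometric unital *-homomorphism. Let Φ : A → A be a positive bounded linear map with ‖Φ‖ < 1 (so that id_A − Φ is an invertible bounded operator on A) and let Ψ : B → B be a positive bounded linear map. Then the map P := (id_B − Ψ) ∘ ι ∘ (id_A − Φ)⁻¹ : A → B is positive if and only if every a ∈ A with 0 ≤ a and Φ(a) ≤ a satisfies Ψ(ι(a)) ≤ ι(a). -/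
/-!
STATEMENT 1: Let A and B be unital complex C*-algebras and let ι : A → B be an isometric
unital *-homomorphism.  Let Φ : A → A be a positive bounded linear map with ‖Φ‖ < 1 (so that
id_A − Φ is an invertible bounded operator on A) and let Ψ : B → B be a positive bounded
linear map.  Then the map P := (id_B − Ψ) ∘ ι ∘ (id_A − Φ)⁻¹ : A → B is positive if and only
if every a ∈ A with 0 ≤ a and Φ(a) ≤ a satisfies Ψ(ι(a)) ≤ ι(a).

Here `(id_A − Φ)⁻¹` is realized as the inverse of the unit `Units.oneSub Φ hΦ` of the Banach
algebra `A →L[ℂ] A`, whose value is `1 - Φ = id_A − Φ`.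
-/

/-- The resolvent `(id - Φ)⁻¹` of a positive map of norm less than one is positive. -/
theorem oneSub_inv_apply_nonneg {A : Type*} [CStarAlgebra A] [PartialOrder A] [StarOrderedRing A]
    (Φ : A →L[ℂ] A) (hΦpos : ∀ a : A, 0 ≤ a → 0 ≤ Φ a) (hΦ : ‖Φ‖ < 1) (a : A) (ha : 0 ≤ a) :
    0 ≤ (((Units.oneSub Φ hΦ)⁻¹ : (A →L[ℂ] A)ˣ) : A →L[ℂ] A) a := by
  have hsum : HasSum (fun n : ℕ => Φ ^ n)
      (((Units.oneSub Φ hΦ)⁻¹ : (A →L[ℂ] A)ˣ) : A →L[ℂ] A) :=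
    (summable_geometric_of_norm_lt_one hΦ).hasSum
  have happ := hsum.mapL (ContinuousLinearMap.apply ℂ A a)
  refine happ.nonneg fun n => ?_
  change 0 ≤ (Φ ^ n) a
  induction n with
  | zero => simpa using ha
  | succ n ih =>
    rw [pow_succ']
    exact hΦpos _ ih

theorem pick_map_positive_iff_lyapunov_domination
    {A B : Type*} [CStarAlgebra A] [CStarAlgebra B]
    [PartialOrder A] [StarOrderedRing A] [PartialOrder B] [StarOrderedRing B]
    (ι : A →⋆ₐ[ℂ] B) (hι : Isometry ι)
    (Φ : A →L[ℂ] A) (Ψ : B →L[ℂ] B)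
    (hΦpos : ∀ a : A, 0 ≤ a → 0 ≤ Φ a)
    (hΨpos : ∀ b : B, 0 ≤ b → 0 ≤ Ψ b)
    (hΦ : ‖Φ‖ < 1) :
    (∀ a : A, 0 ≤ a →
        0 ≤ ι ((((Units.oneSub Φ hΦ)⁻¹ : (A →L[ℂ] A)ˣ) : A →L[ℂ] A) a) -
          Ψ (ι ((((Units.oneSub Φ hΦ)⁻¹ : (A →L[ℂ] A)ˣ) : A →L[ℂ] A) a))) ↔
      (∀ a : A, 0 ≤ a → Φ a ≤ a → Ψ (ι a) ≤ ι a) := by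
  set R := (((Units.oneSub Φ hΦ)⁻¹ : (A →L[ℂ] A)ˣ) : A →L[ℂ] A)
  have hleft : ∀ a, R (a - Φ a) = a := fun a =>
    congrArg (fun T : A →L[ℂ] A => T a) (Units.oneSub Φ hΦ).inv_mul
  have hright : ∀ a, R a - Φ (R a) = a := fun a =>
    congrArg (fun T : A →L[ℂ] A => T a) (Units.oneSub Φ hΦ).mul_inv
  constructor
  · intro h a _ hle
    have hpos := h (a - Φ a) (sub_nonneg.mpr hle)
    rw [hleft] at hpos
    exact sub_nonneg.mp hpos
  · intro h a ha
    refine sub_nonneg.mpr (h (R a) (oneSub_inv_apply_nonneg Φ hΦpos hΦ a ha) ?_)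
    rw [← sub_nonneg, hright]
    exact ha
end

section
/- Let H be a complex Hilbert space, let n ≥ 1, let Z₁,…,Zₙ be pairwise distinct operators on H with ‖Zᵢ‖ < 1 for each i, and let W₁,…,Wₙ be operators on H. Then ‖Φ_Z‖ < 1, so id − Φ_Z is an invertible bounded operator on Mₙ(B(H)), and the following are equivalent: (1) there exists a sequence a : ℕ → ℂ such that for every z ∈ ℂ with |z| < 1 the series ∑ₖ aₖ zᵏ is summable with |∑'ₖ aₖ zᵏ| ≤ 1, and for each i the series ∑ₖ aₖ • Zᵢᵏ is summable in B(H) with sum Wᵢ; (2) the Pick map (id − Φ_W) ∘ (id − Φ_Z)⁻¹ on Mₙ(B(H)) is completely positive. -/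
/-!
STATEMENT 3: Let H be a complex Hilbert space, let n ≥ 1, let Z₁,…,Zₙ be pairwise distinct
operators on H with ‖Zᵢ‖ < 1 for each i, and let W₁,…,Wₙ be operators on H.  Then ‖Φ_Z‖ < 1,
so id − Φ_Z is an invertible bounded operator on Mₙ(B(H)), and the following are equivalent:
(1) there exists a sequence a : ℕ → ℂ such that for every z ∈ ℂ with |z| < 1 the series
∑ₖ aₖ zᵏ is summable with |∑'ₖ aₖ zᵏ| ≤ 1, and for each i the series ∑ₖ aₖ • Zᵢᵏ is summable
in B(H) with sum Wᵢ; (2) the Pick map (id − Φ_W) ∘ (id − Φ_Z)⁻¹ on Mₙ(B(H)) is completely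
positive.

The C*-norm of a matrix `a ∈ Mₙ(B(H))` is `‖toOp a‖`, the operator norm of its canonical
action on `H^n = PiLp 2 (fun _ : Fin n => H)`; `‖Φ_Z‖ < 1` is expressed as
`∃ C < 1, ∀ a, ‖toOp (Φ_Z a)‖ ≤ C * ‖toOp a‖`.  The inverse `(id − Φ_Z)⁻¹` is quantified as
any two-sided function inverse `Q` of `id − Φ_Z` (which is unique).  Positivity in matrix
algebras over B(H) is expressed by the C*-characterization `∃ b, a = star b * b`.
-/

open ContinuousLinearMap

variable {H : Type*} [NormedAddCommGroup H] [InnerProductSpace ℂ H] [CompleteSpace H]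

/-- The map `Φ_Z : a ↦ (Zᵢ ∘ aᵢⱼ ∘ Zⱼ*)` on `Mₙ(B(H))` determined by an `n`-tuple `Z` of
operators on `H`. -/
noncomputable def PhiMap {n : ℕ} (Z : Fin n → H →L[ℂ] H)
    (a : Matrix (Fin n) (Fin n) (H →L[ℂ] H)) : Matrix (Fin n) (Fin n) (H →L[ℂ] H) :=
  Matrix.of fun i j => Z i ∘L a i j ∘L ContinuousLinearMap.adjoint (Z j)

/-- The canonical action of a matrix of operators on the Hilbert space direct sum
`K^m = PiLp 2 (fun _ : Fin m => K)`: `(toOp q) h i = ∑ j, q i j (h j)`.  This realizes the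
isometric *-isomorphism `Mₘ(B(K)) ≃ B(K^m)` giving `Mₘ(B(K))` its C*-norm. -/
noncomputable def toOp {K : Type*} [NormedAddCommGroup K] [InnerProductSpace ℂ K] {m : ℕ}
    (q : Matrix (Fin m) (Fin m) (K →L[ℂ] K)) :
    PiLp 2 (fun _ : Fin m => K) →L[ℂ] PiLp 2 (fun _ : Fin m => K) :=
  (PiLp.continuousLinearEquiv 2 ℂ (fun _ : Fin m => K)).symm.toContinuousLinearMap ∘L
    (ContinuousLinearMap.pi fun i => ∑ j, (q i j) ∘L (ContinuousLinearMap.proj j) ∘L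
      (PiLp.continuousLinearEquiv 2 ℂ (fun _ : Fin m => K)).toContinuousLinearMap)

/-- Interpolation by a function in the closed unit ball of `H^∞(𝔻)`, expressed through its
power series coefficients: `f(z) = ∑ aₖ zᵏ` has modulus at most `1` on the disc and
`f(Zᵢ) = ∑ aₖ Zᵢᵏ = Wᵢ` via the absolutely convergent power-series functional calculus. -/
def InterpolatesHInfty {H : Type*} [NormedAddCommGroup H] [InnerProductSpace ℂ H]
    [CompleteSpace H] {n : ℕ} (Z W : Fin n → H →L[ℂ] H) : Prop :=
  ∃ a : ℕ → ℂ,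
    (∀ z : ℂ, ‖z‖ < 1 →
      Summable (fun k : ℕ => a k * z ^ k) ∧ ‖∑' k : ℕ, a k * z ^ k‖ ≤ 1) ∧
    ∀ i, HasSum (fun k : ℕ => a k • (Z i) ^ k) (W i)

theorem exists_contraction_of_norm_le {X E F : Type*} [AddCommGroup X] [Module ℂ X]
    [NormedAddCommGroup E] [InnerProductSpace ℂ E] [CompleteSpace E]
    [NormedAddCommGroup F] [NormedSpace ℂ F] [CompleteSpace F]
    (v : X →ₗ[ℂ] E) (w : X →ₗ[ℂ] F) (h : ∀ x, ‖w x‖ ≤ ‖v x‖) :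
    ∃ R : E →L[ℂ] F, (∀ y, ‖R y‖ ≤ ‖y‖) ∧ ∀ x, R (v x) = w x := by
  set K := (LinearMap.range v).topologicalClosure with hK
  have : CompleteSpace K := (LinearMap.range v).isClosed_topologicalClosure.completeSpace_coe
  have hmem : ∀ x, v x ∈ K := fun x =>
    (LinearMap.range v).le_topologicalClosure (LinearMap.mem_range_self v x)
  set e : X →ₗ[ℂ] K := v.codRestrict K hmem with he
  have hdense : DenseRange e := by
    rintro ⟨y, hy⟩
    rw [closure_subtype]
    have : Subtype.val '' Set.range e = LinearMap.range v := by
      ext z; simp [he]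
    rw [this]
    exact hy
  have hb : ∀ x, ‖w x‖ ≤ 1 * ‖e x‖ := fun x => by rw [one_mul]; exact h x
  refine ⟨(w.extendOfNorm e) ∘L K.orthogonalProjectionOnto, fun y => ?_, fun x => ?_⟩
  · calc _ ≤ 1 * ‖K.orthogonalProjectionOnto y‖ := LinearMap.norm_extendOfNorm_apply_le hdense 1 hb _
      _ ≤ ‖y‖ := by simpa using K.norm_orthogonalProjectionOnto_apply_le y
  · have : K.orthogonalProjectionOnto (v x) = e x :=
      K.orthogonalProjectionOnto_mem_subspace_eq_self (⟨v x, hmem x⟩ : K)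
    rw [ContinuousLinearMap.comp_apply, this, LinearMap.extendOfNorm_eq hdense ⟨1, hb⟩]

theorem norm_pow_apply_le_of_contraction {E : Type*} [NormedAddCommGroup E]
    [NormedSpace ℂ E] {A : E →L[ℂ] E} (hA : ∀ y, ‖A y‖ ≤ ‖y‖) (k : ℕ) (y : E) :
    ‖(A ^ k) y‖ ≤ ‖y‖ := by
  induction k generalizing y with
  | zero => simp
  | succ k ih => rw [pow_succ, mul_apply_eq_comp]; exact (ih _).trans (hA y)

section Realization

variable {E : Type*} [NormedAddCommGroup E] [InnerProductSpace ℂ E]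

/-- The Taylor coefficients of the transfer function `D + z C (1 - z A)⁻¹ B` of the colligation
with components `A`, `B`, `C`, `D`. -/
noncomputable def transferCoeff (A : E →L[ℂ] E) (B : E) (C : E →L[ℂ] ℂ) (D : ℂ) : ℕ → ℂ
  | 0 => D
  | k + 1 => C ((A ^ k) B)

theorem norm_transferCoeff_le_one {A : E →L[ℂ] E} {B : E} {C : E →L[ℂ] ℂ} {D : ℂ}
    (hU : ∀ (y : E) (c : ℂ), ‖A y + c • B‖ ^ 2 + ‖C y + c * D‖ ^ 2 ≤ ‖y‖ ^ 2 + ‖c‖ ^ 2) (k : ℕ) :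
    ‖transferCoeff A B C D k‖ ≤ 1 := by
  have h0 := hU 0 1
  simp only [map_zero, zero_add, one_smul, one_mul, norm_zero, norm_one] at h0
  have hA : ∀ y, ‖A y‖ ≤ ‖y‖ := fun y => by
    have := hU y 0
    simp only [zero_smul, add_zero, zero_mul, norm_zero] at this
    exact abs_le_of_sq_le_sq' (by nlinarith [sq_nonneg ‖C y‖]) (norm_nonneg _) |>.2
  have hC : ∀ y, ‖C y‖ ≤ ‖y‖ := fun y => by
    have := hU y 0
    simp only [zero_smul, add_zero, zero_mul, norm_zero] at this
    exact abs_le_of_sq_le_sq' (by nlinarith [sq_nonneg ‖A y‖]) (norm_nonneg _) |>.2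
  have hB : ‖B‖ ≤ 1 := by nlinarith [sq_nonneg ‖D‖, norm_nonneg B]
  have hD : ‖D‖ ≤ 1 := by nlinarith [sq_nonneg ‖B‖, norm_nonneg D]
  cases k with
  | zero => exact hD
  | succ k => exact (hC _).trans ((norm_pow_apply_le_of_contraction hA k B).trans hB)

variable [CompleteSpace E]

theorem summable_mul_pow_of_norm_le_one {a : ℕ → ℂ} (ha : ∀ k, ‖a k‖ ≤ 1) {z : ℂ} (hz : ‖z‖ < 1) :
    Summable fun k => a k * z ^ k := by
  refine Summable.of_norm_bounded (summable_geometric_of_lt_one (norm_nonneg z) hz) fun k => ?_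
  rw [norm_mul, norm_pow]
  exact mul_le_of_le_one_left (by positivity) (ha k)

theorem norm_tsum_transferCoeff_le_one {A : E →L[ℂ] E} {B : E} {C : E →L[ℂ] ℂ} {D : ℂ}
    (hU : ∀ (y : E) (c : ℂ), ‖A y + c • B‖ ^ 2 + ‖C y + c * D‖ ^ 2 ≤ ‖y‖ ^ 2 + ‖c‖ ^ 2)
    {z : ℂ} (hz : ‖z‖ < 1) : ‖∑' k, transferCoeff A B C D k * z ^ k‖ ≤ 1 := by
  have hA : ∀ y, ‖A y‖ ≤ ‖y‖ := fun y => by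
    have := hU y 0
    simp only [zero_smul, add_zero, zero_mul, norm_zero] at this
    exact abs_le_of_sq_le_sq' (by nlinarith [sq_nonneg ‖C y‖]) (norm_nonneg _) |>.2
  have hs : Summable fun k : ℕ => z ^ k • (A ^ k) B := by
    refine Summable.of_norm_bounded
      ((summable_geometric_of_lt_one (norm_nonneg z) hz).mul_right ‖B‖) fun k => ?_
    rw [norm_smul, norm_pow]
    exact mul_le_mul_of_nonneg_left (norm_pow_apply_le_of_contraction hA k B) (by positivity)
  set y := ∑' k : ℕ, z ^ k • (A ^ k) B with hy
  have h1 : A (z • y) + (1 : ℂ) • B = y := by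
    conv_rhs => rw [hy, hs.tsum_eq_zero_add]
    rw [map_smul, hy, A.map_tsum hs, ← tsum_const_smul'' z, add_comm]
    simp [smul_smul, pow_succ']
  have h2 : C (z • y) + (1 : ℂ) * D = ∑' k, transferCoeff A B C D k * z ^ k := by
    rw [(summable_mul_pow_of_norm_le_one (norm_transferCoeff_le_one hU) hz).tsum_eq_zero_add]
    rw [map_smul, hy, C.map_tsum hs, ← tsum_const_smul'' z, add_comm]
    congr 1
    · simp [transferCoeff]
    · refine tsum_congr fun k => ?_
      simp [transferCoeff, pow_succ]; ring
  have := hU (z • y) 1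
  rw [h1, h2, norm_smul, norm_one] at this
  have hz2 : ‖z‖ ^ 2 ≤ 1 := by nlinarith [norm_nonneg z]
  have : ‖∑' k, transferCoeff A B C D k * z ^ k‖ ^ 2 ≤ 1 := by
    nlinarith [mul_le_mul_of_nonneg_right hz2 (sq_nonneg ‖y‖)]
  nlinarith [norm_nonneg (∑' k, transferCoeff A B C D k * z ^ k)]

theorem exists_schur_coeff_of_isometry {X : Type*} [AddCommGroup X] [Module ℂ X]
    (d : X →ₗ[ℂ] E) (σ : X →ₗ[ℂ] X) (α β : X →ₗ[ℂ] ℂ)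
    (h : ∀ x, ‖d x‖ ^ 2 + ‖β x‖ ^ 2 ≤ ‖d (σ x)‖ ^ 2 + ‖α x‖ ^ 2) :
    ∃ a : ℕ → ℂ, (∀ k, ‖a k‖ ≤ 1) ∧ (∀ z : ℂ, ‖z‖ < 1 → ‖∑' k, a k * z ^ k‖ ≤ 1) ∧
      ∀ x, Filter.Tendsto (fun N => d ((σ ^ N) x)) Filter.atTop (nhds 0) →
        Filter.Tendsto (fun N => ∑ k ∈ Finset.range N, a k * α ((σ ^ k) x)) Filter.atTop
          (nhds (β x)) := by
  obtain ⟨U, hU, hUx⟩ := exists_contraction_of_norm_le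
    (E := WithLp 2 (E × ℂ)) (F := WithLp 2 (E × ℂ))
    ((WithLp.linearEquiv 2 ℂ (E × ℂ)).symm.toLinearMap ∘ₗ (d ∘ₗ σ).prod α)
    ((WithLp.linearEquiv 2 ℂ (E × ℂ)).symm.toLinearMap ∘ₗ d.prod β) (fun x => by
      rw [← sq_le_sq₀ (norm_nonneg _) (norm_nonneg _)]
      simpa [WithLp.prod_norm_sq_eq_of_L2] using h x)
  let i : (E × ℂ) →L[ℂ] WithLp 2 (E × ℂ) :=
    (WithLp.prodContinuousLinearEquiv 2 ℂ E ℂ).symm.toContinuousLinearMap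
  let p : WithLp 2 (E × ℂ) →L[ℂ] (E × ℂ) :=
    (WithLp.prodContinuousLinearEquiv 2 ℂ E ℂ).toContinuousLinearMap
  let V : (E × ℂ) →L[ℂ] (E × ℂ) := p ∘L U ∘L i
  let A : E →L[ℂ] E := fst ℂ E ℂ ∘L V ∘L inl ℂ E ℂ
  let C : E →L[ℂ] ℂ := snd ℂ E ℂ ∘L V ∘L inl ℂ E ℂ
  let B : E := (V (0, 1)).1
  let D : ℂ := (V (0, 1)).2
  have hV : ∀ (y : E) (c : ℂ), V (y, c) = (A y + c • B, C y + c * D) := fun y c => by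
    have : (y, c) = (y, (0:ℂ)) + c • ((0:E), (1:ℂ)) := by simp
    rw [this, map_add, map_smul]
    rfl
  have hABCD : ∀ (y : E) (c : ℂ),
      ‖A y + c • B‖ ^ 2 + ‖C y + c * D‖ ^ 2 ≤ ‖y‖ ^ 2 + ‖c‖ ^ 2 := fun y c => by
    have h1 := hU (i (y, c))
    rw [← sq_le_sq₀ (norm_nonneg _) (norm_nonneg _), WithLp.prod_norm_sq_eq_of_L2,
      WithLp.prod_norm_sq_eq_of_L2] at h1
    have h2 : (U (i (y, c))).fst = A y + c • B := congrArg Prod.fst (hV y c)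
    have h3 : (U (i (y, c))).snd = C y + c * D := congrArg Prod.snd (hV y c)
    rw [h2, h3] at h1
    exact h1
  have hd : ∀ x, d x = A (d (σ x)) + α x • B ∧ β x = C (d (σ x)) + α x * D := fun x => by
    have h1 : V (d (σ x), α x) = (d x, β x) := congrArg p (hUx x)
    rw [hV] at h1
    exact ⟨(congrArg Prod.fst h1).symm, (congrArg Prod.snd h1).symm⟩
  have key : ∀ x N, β x = ∑ k ∈ Finset.range (N + 1), transferCoeff A B C D k * α ((σ ^ k) x)
      + C ((A ^ N) (d ((σ ^ (N + 1)) x))) := fun x N => by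
    induction N with
    | zero => simp [transferCoeff, (hd x).2]; ring
    | succ N ih =>
      rw [ih, Finset.sum_range_succ _ (N + 1), (hd ((σ ^ (N + 1)) x)).1, map_add, map_smul,
        map_add, map_smul, ← Module.End.mul_apply σ, ← pow_succ',
        ← mul_apply_eq_comp (A ^ N) A, ← pow_succ]
      simp [transferCoeff]; ring
  have hA : ∀ y, ‖A y‖ ≤ ‖y‖ := fun y => by
    have := hABCD y 0
    simp only [zero_smul, add_zero, zero_mul, norm_zero] at this
    exact abs_le_of_sq_le_sq' (by nlinarith [sq_nonneg ‖C y‖]) (norm_nonneg _) |>.2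
  refine ⟨transferCoeff A B C D, norm_transferCoeff_le_one hABCD,
    fun z hz => norm_tsum_transferCoeff_le_one hABCD hz, fun x hx => ?_⟩
  rw [← Filter.tendsto_add_atTop_iff_nat 1]
  have hr : Filter.Tendsto (fun N => C ((A ^ N) (d ((σ ^ (N + 1)) x)))) Filter.atTop (nhds 0) := by
    refine squeeze_zero_norm (fun N => (C.le_opNorm _).trans
      (mul_le_mul_of_nonneg_left (norm_pow_apply_le_of_contraction hA N _) (norm_nonneg _))) ?_
    simpa using ((Filter.tendsto_add_atTop_iff_nat 1).2 hx).norm.const_mul ‖C‖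
  have := (tendsto_const_nhds (x := β x)).sub hr
  rw [sub_zero] at this
  exact this.congr fun N => by rw [key x N]; ring

end Realization

section Toeplitz

open AddCircle in
theorem sum_sq_norm_toeplitz_mul_pow_le {a : ℕ → ℂ}
    (ha : ∀ z : ℂ, ‖z‖ < 1 →
      Summable (fun k : ℕ => a k * z ^ k) ∧ ‖∑' k : ℕ, a k * z ^ k‖ ≤ 1)
    (N : ℕ) (y : ℕ → ℂ) {r : ℝ} (hr0 : 0 < r) (hr1 : r < 1) :
    ∑ m ∈ Finset.range N, ‖(r : ℂ) ^ m * ∑ k ∈ Finset.range (m + 1), a k * y (m - k)‖ ^ 2 ≤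
      ∑ m ∈ Finset.range N, ‖(r : ℂ) ^ m * y m‖ ^ 2 := by
  have hfpow : ∀ (k : ℕ) (t : AddCircle (1 : ℝ)), fourier (k : ℤ) t = (fourier 1 t : ℂ) ^ k := by
    intro k t
    induction k with
    | zero => simp
    | succ k ih => rw [Nat.cast_succ, fourier_add, ih, pow_succ]
  have hsum : Summable fun k : ℕ =>
      (a k * (r : ℂ) ^ k) • (fourier (k : ℤ) : C(AddCircle (1 : ℝ), ℂ)) := by
    refine Summable.of_norm ?_
    simp only [norm_smul, fourier_norm, mul_one]
    exact (ha r (by simpa [abs_of_pos hr0] using hr1)).1.norm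
  set F : C(AddCircle (1 : ℝ), ℂ) := ∑' k : ℕ, (a k * (r : ℂ) ^ k) • fourier (k : ℤ) with hF
  set P : C(AddCircle (1 : ℝ), ℂ) :=
    ∑ q ∈ Finset.range N, ((r : ℂ) ^ q * y q) • fourier (q : ℤ) with hP
  have hF1 : ∀ t, ‖F t‖ ≤ 1 := by
    intro t
    have hz : ‖(r : ℂ) * fourier 1 t‖ < 1 := by
      rw [norm_mul, fourier_apply, Circle.norm_coe]
      simpa [abs_of_pos hr0] using hr1
    have h1 : F t = ∑' k : ℕ, a k * ((r : ℂ) * fourier 1 t) ^ k := by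
      rw [← (ContinuousMap.hasSum_apply hsum.hasSum t).tsum_eq]
      refine tsum_congr fun k => ?_
      rw [ContinuousMap.smul_apply, hfpow, smul_eq_mul, mul_pow, mul_assoc]
    rw [h1]
    exact (ha _ hz).2
  let L : C(AddCircle (1 : ℝ), ℂ) →L[ℂ] MeasureTheory.Lp ℂ 2 (haarAddCircle (T := 1)) :=
    ContinuousMap.toLp 2 haarAddCircle ℂ
  have hLP : ‖L (F * P)‖ ≤ ‖L P‖ := by
    refine MeasureTheory.Lp.norm_le_norm_of_ae_le ?_
    filter_upwards [ContinuousMap.coeFn_toLp (p := 2) (𝕜 := ℂ) haarAddCircle (F * P),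
      ContinuousMap.coeFn_toLp (p := 2) (𝕜 := ℂ) haarAddCircle P] with t h1 h2
    rw [h1, h2, ContinuousMap.mul_apply, norm_mul]
    exact mul_le_of_le_one_left (norm_nonneg _) (hF1 t)
  have horth : Orthonormal ℂ fun m : ℕ => L (fourier (m : ℤ)) :=
    (orthonormal_fourier (T := 1)).comp (fun m : ℕ => (m : ℤ)) Nat.cast_injective
  have hLP2 : ‖L P‖ ^ 2 = ∑ m ∈ Finset.range N, ‖(r : ℂ) ^ m * y m‖ ^ 2 := by
    have h1 : L P = ∑ q ∈ Finset.range N, ((r : ℂ) ^ q * y q) • L (fourier (q : ℤ)) := by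
      simp [hP, map_sum]
    have h2 := horth.inner_sum (fun q => (r : ℂ) ^ q * y q) (fun q => (r : ℂ) ^ q * y q)
      (Finset.range N)
    rw [← h1, inner_self_eq_norm_sq_to_K] at h2
    simp only [RCLike.conj_mul] at h2
    exact_mod_cast h2
  have hcoef : ∀ m ∈ Finset.range N, inner ℂ (L (fourier (m : ℤ))) (L (F * P)) =
      (r : ℂ) ^ m * ∑ k ∈ Finset.range (m + 1), a k * y (m - k) := by
    intro m hm
    have h1 : HasSum (fun k : ℕ => inner ℂ (L (fourier (m : ℤ)))
        (L (((a k * (r : ℂ) ^ k) • fourier (k : ℤ)) * P)))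
        (inner ℂ (L (fourier (m : ℤ))) (L (F * P))) :=
      (hsum.hasSum.mul_right P).mapL (innerSL ℂ (L (fourier (m : ℤ))) ∘L L)
    have h2 : ∀ k : ℕ,
        inner ℂ (L (fourier (m : ℤ))) (L (((a k * (r : ℂ) ^ k) • fourier (k : ℤ)) * P)) =
        if k ≤ m then (r : ℂ) ^ m * (a k * y (m - k)) else 0 := by
      intro k
      have h3 : ((a k * (r : ℂ) ^ k) • (fourier (k : ℤ) : C(AddCircle (1 : ℝ), ℂ))) * P =
          ∑ q ∈ Finset.range N, ((a k * (r : ℂ) ^ k) * ((r : ℂ) ^ q * y q)) •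
            (fourier ((k + q : ℕ) : ℤ) : C(AddCircle (1 : ℝ), ℂ)) := by
        rw [hP, Finset.mul_sum]
        refine Finset.sum_congr rfl fun q _ => ?_
        ext t
        simp only [ContinuousMap.mul_apply, ContinuousMap.smul_apply, smul_eq_mul, hfpow, pow_add]
        ring
      have h4 : ∀ q : ℕ, inner ℂ (L (fourier (m : ℤ))) (L (fourier ((k + q : ℕ) : ℤ))) =
          if m = k + q then (1 : ℂ) else 0 := fun q =>
        orthonormal_iff_ite.1 horth m (k + q)
      rw [h3, map_sum, inner_sum]
      simp only [map_smul, inner_smul_right, h4, mul_ite, mul_one, mul_zero]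
      split_ifs with hk
      · rw [Finset.sum_eq_single (m - k)]
        · rw [if_pos (by omega)]
          have : (r : ℂ) ^ m = r ^ k * r ^ (m - k) := by rw [← pow_add]; congr 1; omega
          rw [this]; ring
        · intro q _ hq; rw [if_neg (by omega)]
        · intro hq; simp only [Finset.mem_range] at hq hm; omega
      · exact Finset.sum_eq_zero fun q _ => if_neg (by omega)
    have h5 : HasSum (fun k : ℕ => if k ≤ m then (r : ℂ) ^ m * (a k * y (m - k)) else 0)
        (inner ℂ (L (fourier (m : ℤ))) (L (F * P))) := by
      simpa only [h2] using h1
    refine h5.unique ?_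
    have h6 : (r : ℂ) ^ m * ∑ k ∈ Finset.range (m + 1), a k * y (m - k) =
        ∑ k ∈ Finset.range (m + 1), if k ≤ m then (r : ℂ) ^ m * (a k * y (m - k)) else 0 := by
      rw [Finset.mul_sum]
      exact Finset.sum_congr rfl fun k hk => (if_pos (by simp at hk; omega)).symm
    rw [h6]
    exact hasSum_sum_of_ne_finset_zero fun k hk => if_neg (by simpa using hk)
  calc _ = ∑ m ∈ Finset.range N, ‖inner ℂ (L (fourier (m : ℤ))) (L (F * P))‖ ^ 2 :=
        Finset.sum_congr rfl fun m hm => by rw [hcoef m hm]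
    _ ≤ ‖L (F * P)‖ ^ 2 := horth.sum_inner_products_le _
    _ ≤ ‖L P‖ ^ 2 := by gcongr
    _ = _ := hLP2

theorem sum_sq_norm_toeplitz_le {a : ℕ → ℂ}
    (ha : ∀ z : ℂ, ‖z‖ < 1 →
      Summable (fun k : ℕ => a k * z ^ k) ∧ ‖∑' k : ℕ, a k * z ^ k‖ ≤ 1) (N : ℕ) (y : ℕ → ℂ) :
    ∑ m ∈ Finset.range N, ‖∑ k ∈ Finset.range (m + 1), a k * y (m - k)‖ ^ 2 ≤
      ∑ m ∈ Finset.range N, ‖y m‖ ^ 2 := by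
  have hc : ∀ c : ℕ → ℂ, Filter.Tendsto
      (fun r : ℝ => ∑ m ∈ Finset.range N, ‖(r : ℂ) ^ m * c m‖ ^ 2) (nhdsWithin 1 (Set.Iio 1))
      (nhds (∑ m ∈ Finset.range N, ‖c m‖ ^ 2)) := fun c => by
    have : Continuous fun r : ℝ => ∑ m ∈ Finset.range N, ‖(r : ℂ) ^ m * c m‖ ^ 2 := by fun_prop
    simpa using (this.tendsto 1).mono_left nhdsWithin_le_nhds
  refine le_of_tendsto_of_tendsto (hc fun m => ∑ k ∈ Finset.range (m + 1), a k * y (m - k))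
    (hc y) ?_
  filter_upwards [Ioo_mem_nhdsLT (zero_lt_one' ℝ)] with r hr
  exact sum_sq_norm_toeplitz_mul_pow_le ha N y hr.1 hr.2

theorem sum_sq_norm_adjoint_toeplitz_le {a : ℕ → ℂ}
    (ha : ∀ z : ℂ, ‖z‖ < 1 →
      Summable (fun k : ℕ => a k * z ^ k) ∧ ‖∑' k : ℕ, a k * z ^ k‖ ≤ 1) (N : ℕ) (x : ℕ → ℂ) :
    ∑ p ∈ Finset.range N, ‖∑ k ∈ Finset.range (N - p), a k * x (p + k)‖ ^ 2 ≤
      ∑ p ∈ Finset.range N, ‖x p‖ ^ 2 := by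
  have h := sum_sq_norm_toeplitz_le ha N fun q => x (N - 1 - q)
  rw [Finset.sum_range_reflect (fun p => ‖x p‖ ^ 2) N] at h
  rw [← Finset.sum_range_reflect]
  refine le_trans (le_of_eq (Finset.sum_congr rfl fun m hm => ?_)) h
  rw [Finset.mem_range] at hm
  have : N - (N - 1 - m) = m + 1 := by omega
  rw [this]
  congr 2
  refine Finset.sum_congr rfl fun k hk => ?_
  rw [Finset.mem_range] at hk
  congr 2
  omega

end Toeplitz

theorem summable_pow_mul_mul_pow {R : Type*} [NormedRing R] [CompleteSpace R] {A B : R}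
    (hA : ‖A‖ < 1) (hB : ‖B‖ < 1) (x : R) : Summable fun m : ℕ => A ^ m * x * B ^ m := by
  have hsA := (summable_norm_geometric_of_norm_lt_one hA)
  have hB1 : ∀ m, ‖B ^ (m + 1)‖ ≤ 1 := fun m =>
    (norm_pow_le' B m.succ_pos).trans (pow_le_one₀ (norm_nonneg _) hB.le)
  rw [← summable_nat_add_iff 1]
  refine Summable.of_norm_bounded (((summable_nat_add_iff 1).2 hsA).mul_right ‖x‖) fun m => ?_
  calc _ ≤ ‖A ^ (m + 1)‖ * ‖x‖ * ‖B ^ (m + 1)‖ := (norm_mul_le _ _).trans (by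
        gcongr; exact norm_mul_le _ _)
    _ ≤ _ := mul_le_of_le_one_right (by positivity) (hB1 m)

theorem hasSum_pow_mul_mul_pow {R : Type*} [NormedRing R] [CompleteSpace R] {A B x q : R}
    (hA : ‖A‖ < 1) (hB : ‖B‖ < 1) (h : q - A * q * B = x) :
    HasSum (fun m : ℕ => A ^ m * x * B ^ m) q := by
  have hs := summable_pow_mul_mul_pow hA hB x
  rw [hs.hasSum_iff_tendsto_nat]
  have hp : ∀ N, ∑ m ∈ Finset.range N, A ^ m * x * B ^ m = q - A ^ N * q * B ^ N := by
    intro N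
    induction N with
    | zero => simp
    | succ N ih => rw [Finset.sum_range_succ, ih, ← h, pow_succ A, pow_succ' B]; noncomm_ring
  simp only [hp]
  have : Filter.Tendsto (fun N => A ^ N * q * B ^ N) Filter.atTop (nhds 0) := by
    simpa using ((tendsto_pow_atTop_nhds_zero_of_norm_lt_one hA).mul_const q).mul
      (tendsto_pow_atTop_nhds_zero_of_norm_lt_one hB)
  simpa using tendsto_const_nhds.sub this

theorem bijective_sub_mul_mul {R : Type*} [NormedRing R] [CompleteSpace R] {A B : R}
    (hA : ‖A‖ < 1) (hB : ‖B‖ < 1) : Function.Bijective fun q : R => q - A * q * B := by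
  refine ⟨fun q q' h => (hasSum_pow_mul_mul_pow hA hB h).unique
    (hasSum_pow_mul_mul_pow hA hB rfl), fun x => ?_⟩
  have hs := summable_pow_mul_mul_pow hA hB x
  refine ⟨∑' m : ℕ, A ^ m * x * B ^ m, ?_⟩
  dsimp only
  rw [← hs.tsum_mul_left A, ← (hs.mul_left A).tsum_mul_right B, sub_eq_iff_eq_add,
    hs.tsum_eq_zero_add]
  congr 1
  · simp
  · exact tsum_congr fun m => by rw [pow_succ' A, pow_succ B]; noncomm_ring

theorem tendsto_toeplitz_compression {R : Type*} [NormedRing R] [NormedAlgebra ℂ R]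
    [CompleteSpace R] {A B x q V W : R} (hA : ‖A‖ < 1) (hB : ‖B‖ < 1) (h : q - A * q * B = x)
    {a b : ℕ → ℂ} (hV : HasSum (fun k => a k • A ^ k) V) (hW : HasSum (fun k => b k • B ^ k) W) :
    Filter.Tendsto (fun N => ∑ p ∈ Finset.range N, A ^ p * x * B ^ p -
      ∑ p ∈ Finset.range N, (∑ k ∈ Finset.range (N - p), a k • A ^ (p + k)) * x *
        (∑ k ∈ Finset.range (N - p), b k • B ^ (p + k))) Filter.atTop
      (nhds (q - V * q * W)) := by
  have hq := hasSum_pow_mul_mul_pow hA hB h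
  refine hq.tendsto_sum_nat.sub ?_
  set S : ℕ → R := fun N => ∑ k ∈ Finset.range N, a k • A ^ k with hS
  set T : ℕ → R := fun N => ∑ k ∈ Finset.range N, b k • B ^ k with hT
  have hSV : Filter.Tendsto S Filter.atTop (nhds V) := hV.tendsto_sum_nat
  have hTW : Filter.Tendsto T Filter.atTop (nhds W) := hW.tendsto_sum_nat
  obtain ⟨c, hc⟩ := hSV.norm.bddAbove_range
  obtain ⟨d, hd⟩ := hTW.norm.bddAbove_range
  have hc' : ∀ N, ‖S N‖ ≤ c := fun N => hc ⟨N, rfl⟩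
  have hd' : ∀ N, ‖T N‖ ≤ d := fun N => hd ⟨N, rfl⟩
  have hc0 : 0 ≤ c := (norm_nonneg _).trans (hc' 0)
  have hd0 : 0 ≤ d := (norm_nonneg _).trans (hd' 0)
  have hsplit : ∀ N p, (∑ k ∈ Finset.range (N - p), a k • A ^ (p + k)) * x *
      (∑ k ∈ Finset.range (N - p), b k • B ^ (p + k)) =
      S (N - p) * (A ^ p * x * B ^ p) * T (N - p) := fun N p => by
    have h1 : ∑ k ∈ Finset.range (N - p), a k • A ^ (p + k) = S (N - p) * A ^ p := by
      rw [hS, Finset.sum_mul]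
      exact Finset.sum_congr rfl fun k _ => by rw [smul_mul_assoc, ← pow_add, add_comm]
    have h2 : ∑ k ∈ Finset.range (N - p), b k • B ^ (p + k) = B ^ p * T (N - p) := by
      rw [hT, Finset.mul_sum]
      exact Finset.sum_congr rfl fun k _ => by rw [mul_smul_comm, ← pow_add]
    rw [h1, h2]; noncomm_ring
  have hlim : HasSum (fun p => V * (A ^ p * x * B ^ p) * W) (V * q * W) :=
    (hq.mul_left V).mul_right W
  rw [← hlim.tsum_eq]
  have hfin : ∀ N, ∑ p ∈ Finset.range N, (∑ k ∈ Finset.range (N - p), a k • A ^ (p + k)) * x *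
        (∑ k ∈ Finset.range (N - p), b k • B ^ (p + k)) =
      ∑' p, S (N - p) * (A ^ p * x * B ^ p) * T (N - p) := fun N => by
    rw [tsum_eq_sum (s := Finset.range N)]
    · exact Finset.sum_congr rfl fun p _ => hsplit N p
    · intro p hp
      have : N - p = 0 := by simpa [Nat.sub_eq_zero_iff_le] using hp
      simp [this, hS]
  simp only [hfin]
  have hsA := (summable_norm_geometric_of_norm_lt_one hA)
  refine tendsto_tsum_of_dominated_convergence
    (bound := fun p => c * (‖A ^ p‖ * ‖x‖ * (1 + ‖(1 : R)‖)) * d)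
    (((hsA.mul_right _).mul_right _ |>.mul_left c).mul_right d) (fun p => ?_)
    (Filter.Eventually.of_forall fun N p => ?_)
  · have hsub : Filter.Tendsto (fun N => N - p) Filter.atTop Filter.atTop :=
      Filter.tendsto_sub_atTop_nat p
    exact ((hSV.comp hsub).mul_const _).mul (hTW.comp hsub)
  · have hBp : ‖B ^ p‖ ≤ 1 + ‖(1 : R)‖ := by
      cases p with
      | zero => simp
      | succ m =>
        have := (norm_pow_le' B m.succ_pos).trans (pow_le_one₀ (norm_nonneg _) hB.le)
        linarith [norm_nonneg (1 : R)]
    calc _ ≤ ‖S (N - p)‖ * (‖A ^ p‖ * ‖x‖ * ‖B ^ p‖) * ‖T (N - p)‖ := by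
          refine (norm_mul_le _ _).trans ?_
          gcongr
          refine (norm_mul_le _ _).trans ?_
          gcongr
          refine (norm_mul_le _ _).trans ?_
          gcongr
          exact norm_mul_le _ _
      _ ≤ _ := by gcongr <;> first | exact hc' _ | exact hd' _

theorem CStarAlgebra.starNonneg_of_nonneg {A : Type*} [NonUnitalCStarAlgebra A] [PartialOrder A]
    [StarOrderedRing A] {a : A} (ha : 0 ≤ a) : StarNonneg a :=
  CStarAlgebra.nonneg_iff_eq_star_mul_self.1 ha

theorem starNonneg_of_tendsto {A : Type*} [CStarAlgebra A] [PartialOrder A] [StarOrderedRing A]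
    {k n : ℕ} {M : ℕ → Matrix (Fin k) (Fin k) (Matrix (Fin n) (Fin n) A)}
    {L : Matrix (Fin k) (Fin k) (Matrix (Fin n) (Fin n) A)}
    (hM : ∀ N, ∃ e : Fin N → Matrix (Fin k) (Fin k) (Matrix (Fin n) (Fin n) A),
      M N = ∑ m, star (e m) * e m)
    (hL : ∀ s t i j, Filter.Tendsto (fun N => M N s t i j) Filter.atTop (nhds (L s t i j))) :
    StarNonneg L := by
  let M' : ℕ → CStarMatrix (Fin k) (Fin k) (CStarMatrix (Fin n) (Fin n) A) := M
  let L' : CStarMatrix (Fin k) (Fin k) (CStarMatrix (Fin n) (Fin n) A) := L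
  have hM' : ∀ N, 0 ≤ M' N := fun N => by
    obtain ⟨e, he⟩ := hM N
    let e' : Fin N → CStarMatrix (Fin k) (Fin k) (CStarMatrix (Fin n) (Fin n) A) := e
    have : M' N = ∑ m, star (e' m) * e' m := he
    rw [this]
    exact Finset.sum_nonneg fun m _ => star_mul_self_nonneg (e' m)
  have hlim : Filter.Tendsto M' Filter.atTop (nhds L') :=
    tendsto_pi_nhds.2 fun s => tendsto_pi_nhds.2 fun t =>
      tendsto_pi_nhds.2 fun i => tendsto_pi_nhds.2 fun j => hL s t i j
  have h0 : 0 ≤ L' := ge_of_tendsto hlim (Filter.Eventually.of_forall hM')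
  obtain ⟨b, hb⟩ := CStarAlgebra.starNonneg_of_nonneg h0
  exact ⟨b, hb⟩

theorem sum_range_sub_eq_sum_fin {M : Type*} [AddCommMonoid M] (N : ℕ) (p : ℕ) (g : ℕ → ℕ → M) :
    ∑ k ∈ Finset.range (N - p), g k (p + k) =
      ∑ k : Fin N, if p ≤ k then g (k - p) k else 0 := by
  rw [Fin.sum_univ_eq_sum_range (fun k => if p ≤ k then g (k - p) k else 0) N,
    ← Finset.sum_filter]
  refine Finset.sum_bij' (fun k _ => p + k) (fun k _ => k - p) ?_ ?_ ?_ ?_ ?_ <;>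
    simp only [Finset.mem_range, Finset.mem_filter]
  · intro k hk; omega
  · intro k hk; omega
  · intro k hk; omega
  · intro k hk; omega
  · intro k hk; rw [Nat.add_sub_cancel_left]

open scoped MatrixOrder ComplexOrder in
theorem exists_toeplitz_defect_factorization {a : ℕ → ℂ}
    (ha : ∀ z : ℂ, ‖z‖ < 1 →
      Summable (fun k : ℕ => a k * z ^ k) ∧ ‖∑' k : ℕ, a k * z ^ k‖ ≤ 1) (N : ℕ) :
    ∃ c : Fin N → Fin N → ℂ, ∀ k l : Fin N,
      (if k = l then 1 else 0) - ∑ p : Fin N,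
        (if p ≤ k then a (k - p : ℕ) else 0) * star (if p ≤ l then a (l - p : ℕ) else 0) =
      ∑ m, c m k * star (c m l) := by
  let T : Matrix (Fin N) (Fin N) ℂ := Matrix.of fun p k => if p ≤ k then a (k - p : ℕ) else 0
  have hT : (1 - T.conjTranspose * T).PosSemidef := by
    refine .of_dotProduct_mulVec_nonneg
      (Matrix.isHermitian_one.sub (Matrix.isHermitian_conjTranspose_mul_self T)) fun x => ?_
    have hsq : ∀ v : Fin N → ℂ, star v ⬝ᵥ v = ((∑ p, ‖v p‖ ^ 2 : ℝ) : ℂ) := fun v => by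
      simp [dotProduct, Complex.conj_mul']
    rw [Matrix.sub_mulVec, Matrix.one_mulVec, dotProduct_sub, ← Matrix.mulVec_mulVec,
      Matrix.dotProduct_mulVec, ← Matrix.star_mulVec, hsq, hsq, sub_nonneg, Complex.real_le_real]
    have h := sum_sq_norm_adjoint_toeplitz_le ha N fun q => if h : q < N then x ⟨q, h⟩ else 0
    rw [← Fin.sum_univ_eq_sum_range
      (fun p =>
        ‖∑ k ∈ Finset.range (N - p), a k * (if h : p + k < N then x ⟨p + k, h⟩ else 0)‖ ^ 2),
      ← Fin.sum_univ_eq_sum_range (fun p => ‖if h : p < N then x ⟨p, h⟩ else 0‖ ^ 2)] at h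
    simp only [Fin.is_lt, dif_pos] at h
    refine le_trans (le_of_eq (Finset.sum_congr rfl fun p _ => ?_)) h
    rw [sum_range_sub_eq_sum_fin N p fun k q => a k * (if h : q < N then x ⟨q, h⟩ else 0)]
    refine congrArg (fun z : ℂ => ‖z‖ ^ 2) ?_
    simp [T, Matrix.mulVec, dotProduct, ite_mul]
  obtain ⟨B, hB⟩ := CStarAlgebra.nonneg_iff_eq_star_mul_self.1 hT.nonneg
  refine ⟨fun m k => B m k, fun k l => ?_⟩
  have h := congrArg star (congrFun (congrFun hB k) l)
  simp only [Matrix.sub_apply, Matrix.mul_apply, Matrix.one_apply, Matrix.star_apply,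
    Matrix.conjTranspose_apply, star_sub, star_sum, star_mul', star_star, T, Matrix.of_apply] at h
  rw [← h]
  split_ifs <;> simp

theorem sum_toeplitz_defect_eq {R : Type*} [Ring R] [Algebra ℂ R] {a : ℕ → ℂ} {N : ℕ}
    {c : Fin N → Fin N → ℂ}
    (hc : ∀ k l : Fin N, (if k = l then 1 else 0) - ∑ p : Fin N,
        (if p ≤ k then a (k - p : ℕ) else 0) * star (if p ≤ l then a (l - p : ℕ) else 0) =
      ∑ m, c m k * star (c m l)) (A B x : R) :
    ∑ p ∈ Finset.range N, A ^ p * x * B ^ p -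
      ∑ p ∈ Finset.range N, (∑ k ∈ Finset.range (N - p), a k • A ^ (p + k)) * x *
        (∑ k ∈ Finset.range (N - p), star (a k) • B ^ (p + k)) =
    ∑ m, (∑ k : Fin N, c m k • A ^ (k : ℕ)) * x * (∑ l : Fin N, star (c m l) • B ^ (l : ℕ)) := by
  have hexp : ∀ u v : Fin N → ℂ, (∑ k, u k • A ^ (k : ℕ)) * x * (∑ l, v l • B ^ (l : ℕ)) =
      ∑ k, ∑ l, (u k * v l) • (A ^ (k : ℕ) * x * B ^ (l : ℕ)) := fun u v => by
    rw [Finset.sum_mul, Finset.sum_mul_sum]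
    refine Finset.sum_congr rfl fun k _ => Finset.sum_congr rfl fun l _ => ?_
    rw [smul_mul_assoc, smul_mul_smul_comm]
  have h1 : ∑ p ∈ Finset.range N, A ^ p * x * B ^ p =
      ∑ k : Fin N, ∑ l : Fin N, (if k = l then (1 : ℂ) else 0) •
        (A ^ (k : ℕ) * x * B ^ (l : ℕ)) := by
    simp [← Fin.sum_univ_eq_sum_range (fun p => A ^ p * x * B ^ p)]
  have h2 : ∀ p : Fin N, (∑ k ∈ Finset.range (N - p), a k • A ^ (p + k : ℕ)) * x *
        (∑ k ∈ Finset.range (N - p), star (a k) • B ^ (p + k : ℕ)) =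
      ∑ k : Fin N, ∑ l : Fin N, ((if p ≤ k then a (k - p : ℕ) else 0) *
        star (if p ≤ l then a (l - p : ℕ) else 0)) • (A ^ (k : ℕ) * x * B ^ (l : ℕ)) := fun p => by
    rw [sum_range_sub_eq_sum_fin N p fun k q => a k • A ^ q,
      sum_range_sub_eq_sum_fin N p fun k q => star (a k) • B ^ q, ← hexp]
    congr 2
    · simp [ite_smul]
    · simp [ite_smul, apply_ite]
  have hcomm : ∀ f : Fin N → Fin N → Fin N → R,
      ∑ m, ∑ k, ∑ l, f m k l = ∑ k, ∑ l, ∑ m, f m k l :=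
    fun f => by
      rw [Finset.sum_comm]
      exact Finset.sum_congr rfl fun k _ => Finset.sum_comm
  simp only [hexp]
  rw [hcomm fun m k l => (c m k * star (c m l)) • (A ^ (k : ℕ) * x * B ^ (l : ℕ)), h1,
    ← Fin.sum_univ_eq_sum_range (fun p =>
      (∑ k ∈ Finset.range (N - p), a k • A ^ (p + k)) * x *
        (∑ k ∈ Finset.range (N - p), star (a k) • B ^ (p + k))), Finset.sum_congr rfl fun p _ => h2 p,
    hcomm, ← Finset.sum_sub_distrib]
  refine Finset.sum_congr rfl fun k _ => ?_
  rw [← Finset.sum_sub_distrib]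
  refine Finset.sum_congr rfl fun l _ => ?_
  rw [← Finset.sum_smul, ← Finset.sum_smul, ← sub_smul, hc]

theorem completelyPositive_of_interpolatesHInfty {n : ℕ} {Z W : Fin n → H →L[ℂ] H}
    (hZ : ∀ i, ‖Z i‖ < 1) (hf : InterpolatesHInfty Z W)
    {Q : Matrix (Fin n) (Fin n) (H →L[ℂ] H) → Matrix (Fin n) (Fin n) (H →L[ℂ] H)}
    (hQ : ∀ x i j, Q x i j - Z i * Q x i j * star (Z j) = x i j) :
    CompletelyPositive fun a : Matrix (Fin n) (Fin n) (H →L[ℂ] H) => Q a - PhiMap W (Q a) := by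
  obtain ⟨f, hf, hW⟩ := hf
  rintro k - _ ⟨b, rfl⟩
  choose c hc using exists_toeplitz_defect_factorization hf
  let P : ∀ N, Fin N → Fin n → H →L[ℂ] H := fun N m i => ∑ k : Fin N, c N m k • Z i ^ (k : ℕ)
  refine starNonneg_of_tendsto (M := fun N => ∑ m, star (Matrix.of fun r t => Matrix.of fun l j =>
    b r t l j * star (P N m j)) * (Matrix.of fun r t => Matrix.of fun l j =>
    b r t l j * star (P N m j))) (fun N => ⟨_, rfl⟩) fun s t i j => ?_
  have hZ' : ‖star (Z j)‖ < 1 := by rw [norm_star]; exact hZ j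
  have hW' : HasSum (fun k => star (f k) • star (Z j) ^ k) (star (W j)) := by
    simpa only [star_smul, star_pow] using (hW j).star
  refine (tendsto_toeplitz_compression (hZ i) hZ' (hQ ((star b * b) s t) i j) (hW i) hW').congr
    fun N => ?_
  rw [sum_toeplitz_defect_eq (hc N)]
  simp only [Matrix.sum_apply]
  refine Finset.sum_congr rfl fun m _ => ?_
  have hstar : ∑ l : Fin N, star (c N m l) • star (Z j) ^ (l : ℕ) = star (P N m j) := by
    simp only [P, star_sum, star_smul, star_pow]
  rw [hstar, show ∑ k : Fin N, c N m k • Z i ^ (k : ℕ) = P N m i from rfl]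
  simp only [Matrix.mul_apply, Matrix.star_apply, Matrix.sum_apply, Matrix.of_apply, star_mul,
    star_star, Finset.mul_sum, Finset.sum_mul, mul_assoc]

theorem PiLp.norm_toLp_apply_le {ι : Type*} [Fintype ι] {E : Type*} [SeminormedAddCommGroup E]
    {r : ℝ} (hr : 0 ≤ r) {T : ι → E → E} (hT : ∀ i x, ‖T i x‖ ≤ r * ‖x‖)
    (h : PiLp 2 fun _ : ι => E) :
    ‖(WithLp.toLp 2 fun i => T i (h i) : PiLp 2 fun _ : ι => E)‖ ≤ r * ‖h‖ := by
  rw [PiLp.norm_eq_of_L2, PiLp.norm_eq_of_L2, ← Real.sqrt_sq hr, ← Real.sqrt_mul (sq_nonneg r),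
    Finset.mul_sum]
  refine Real.sqrt_le_sqrt (Finset.sum_le_sum fun i _ => ?_)
  rw [← mul_pow]
  exact pow_le_pow_left₀ (norm_nonneg _) (hT i _) 2

theorem toOp_apply {K : Type*} [NormedAddCommGroup K] [InnerProductSpace ℂ K] {m : ℕ}
    (q : Matrix (Fin m) (Fin m) (K →L[ℂ] K)) (h : PiLp 2 fun _ : Fin m => K) (i : Fin m) :
    toOp q h i = ∑ j, q i j (h j) := by
  simp [toOp]

theorem norm_toOp_phiMap_le {n : ℕ} {Z : Fin n → H →L[ℂ] H} {r : ℝ} (hr : 0 ≤ r)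
    (hZ : ∀ i, ‖Z i‖ ≤ r) (a : Matrix (Fin n) (Fin n) (H →L[ℂ] H)) :
    ‖toOp (PhiMap Z a)‖ ≤ r * r * ‖toOp a‖ := by
  refine opNorm_le_bound _ (by positivity) fun h => ?_
  have key : toOp (PhiMap Z a) h = WithLp.toLp 2 fun i =>
      Z i (toOp a (WithLp.toLp 2 fun j => adjoint (Z j) (h j)) i) := by
    ext i
    simp [toOp_apply, PhiMap, map_sum]
  have hZ' : ∀ i x, ‖Z i x‖ ≤ r * ‖x‖ := fun i x => (Z i).le_of_opNorm_le (hZ i) x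
  have hZ'' : ∀ i x, ‖adjoint (Z i) x‖ ≤ r * ‖x‖ := fun i x =>
    (adjoint (Z i)).le_of_opNorm_le ((LinearIsometryEquiv.norm_map adjoint (Z i)).le.trans (hZ i)) x
  rw [key]
  calc _ ≤ r * ‖toOp a (WithLp.toLp 2 fun j => adjoint (Z j) (h j))‖ :=
        PiLp.norm_toLp_apply_le hr hZ' _
    _ ≤ r * (‖toOp a‖ * (r * ‖h‖)) := by
        gcongr
        exact (le_opNorm _ _).trans (by gcongr; exact PiLp.norm_toLp_apply_le hr hZ'' h)
    _ = _ := by ring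

theorem exists_norm_toOp_phiMap_le {n : ℕ} {Z : Fin n → H →L[ℂ] H} (hZ : ∀ i, ‖Z i‖ < 1) :
    ∃ C : ℝ, C < 1 ∧ ∀ a : Matrix (Fin n) (Fin n) (H →L[ℂ] H),
      ‖toOp (PhiMap Z a)‖ ≤ C * ‖toOp a‖ := by
  obtain ⟨r, hr0, hr1, hr⟩ : ∃ r : ℝ, 0 ≤ r ∧ r < 1 ∧ ∀ i, ‖Z i‖ ≤ r := by
    rcases isEmpty_or_nonempty (Fin n) with h | h
    · exact ⟨0, le_rfl, one_pos, fun i => h.elim i⟩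
    · obtain ⟨i, hi⟩ := Finite.exists_max fun i => ‖Z i‖
      exact ⟨‖Z i‖, norm_nonneg _, hZ i, hi⟩
  exact ⟨r * r, by nlinarith, norm_toOp_phiMap_le hr0 hr⟩

theorem bijective_sub_phiMap {n : ℕ} {Z : Fin n → H →L[ℂ] H} (hZ : ∀ i, ‖Z i‖ < 1) :
    Function.Bijective fun a : Matrix (Fin n) (Fin n) (H →L[ℂ] H) => a - PhiMap Z a := by
  have hb : ∀ i j, Function.Bijective fun q : H →L[ℂ] H => q - Z i * q * star (Z j) := fun i j =>
    bijective_sub_mul_mul (hZ i) ((norm_star (Z j)).trans_lt (hZ j))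
  refine ⟨fun a a' h => ?_, fun x => ?_⟩
  · ext1 i j
    exact (hb i j).1 (congrFun (congrFun h i) j)
  · choose q hq using fun i j => (hb i j).2 (x i j)
    exact ⟨q, by ext1 i j; exact hq i j⟩

theorem exists_norm_sq_eq_sub_of_contraction {E F : Type*} [NormedAddCommGroup E]
    [InnerProductSpace ℂ E] [CompleteSpace E] [NormedAddCommGroup F] [InnerProductSpace ℂ F]
    [CompleteSpace F] (R : E →L[ℂ] F) (hR : ∀ y, ‖R y‖ ≤ ‖y‖) :
    ∃ b : E →L[ℂ] E, ∀ y, ‖b y‖ ^ 2 = ‖y‖ ^ 2 - ‖R y‖ ^ 2 := by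
  have hre : ∀ y, (inner ℂ y ((1 - adjoint R ∘L R) y)).re = ‖y‖ ^ 2 - ‖R y‖ ^ 2 := fun y => by
    simp [adjoint_inner_right, inner_self_eq_norm_sq_to_K, ← Complex.ofReal_pow]
  have h0 : (0 : E →L[ℂ] E) ≤ 1 - adjoint R ∘L R := by
    rw [nonneg_iff_isPositive, isPositive_def']
    refine ⟨?_, fun y => ?_⟩
    · exact (IsSelfAdjoint.one _).sub (isPositive_adjoint_comp_self R).isSelfAdjoint
    · rw [reApplyInnerSelf, ← inner_conj_symm, RCLike.conj_re]
      refine le_of_le_of_eq ?_ (hre y).symm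
      exact sub_nonneg.2 (pow_le_pow_left₀ (norm_nonneg _) (hR y) 2)
  obtain ⟨b, hb⟩ := CStarAlgebra.nonneg_iff_eq_star_mul_self.1 h0
  refine ⟨b, fun y => ?_⟩
  rw [← hre, hb, mul_apply_eq_comp, star_eq_adjoint, adjoint_inner_right,
    inner_self_eq_norm_sq_to_K]
  simp [← Complex.ofReal_pow]

theorem lp.hasSum_norm_sq {ι : Type*} {G : ι → Type*} [∀ i, NormedAddCommGroup (G i)]
    (f : lp G 2) : HasSum (fun i => ‖f i‖ ^ 2) (‖f‖ ^ 2) := by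
  simpa using lp.hasSum_norm (p := 2) (by simp) f

theorem lp.norm_sq_eq_add_of_shift {G : Type*} [NormedAddCommGroup G]
    {f g : lp (fun _ : ℕ => G) 2} (h : ∀ m, g m = f (m + 1)) : ‖f‖ ^ 2 = ‖f 0‖ ^ 2 + ‖g‖ ^ 2 := by
  refine (lp.hasSum_norm_sq f).unique ?_
  rw [← hasSum_nat_add_iff' 1]
  simpa [h] using lp.hasSum_norm_sq g

theorem exists_schur_coeff_of_shift_dominated {X : Type*} [AddCommGroup X] [Module ℂ X]
    (v w : X →ₗ[ℂ] lp (fun _ : ℕ => ℂ) 2) (σ : X →ₗ[ℂ] X)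
    (hv : ∀ x m, v (σ x) m = v x (m + 1)) (hw : ∀ x m, w (σ x) m = w x (m + 1))
    (h : ∀ x, ‖w x‖ ≤ ‖v x‖) :
    ∃ a : ℕ → ℂ, (∀ k, ‖a k‖ ≤ 1) ∧ (∀ z : ℂ, ‖z‖ < 1 → ‖∑' k, a k * z ^ k‖ ≤ 1) ∧
      ∀ x, Filter.Tendsto (fun N => ∑ k ∈ Finset.range N, a k * v x k) Filter.atTop
        (nhds (w x 0)) := by
  obtain ⟨R, hR, hRv⟩ := exists_contraction_of_norm_le v w h
  obtain ⟨b, hb⟩ := exists_norm_sq_eq_sub_of_contraction R hR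
  obtain ⟨a, ha, ha', hlim⟩ := exists_schur_coeff_of_isometry (b.toLinearMap ∘ₗ v) σ
    (lp.evalₗ (fun _ : ℕ => ℂ) 2 0 ∘ₗ v) (lp.evalₗ (fun _ : ℕ => ℂ) 2 0 ∘ₗ w) fun x => by
      simp only [LinearMap.comp_apply, coe_coe, hb, hRv, lp.evalₗ_apply]
      linarith [lp.norm_sq_eq_add_of_shift (hv x), lp.norm_sq_eq_add_of_shift (hw x)]
  have hpow : ∀ x k m, v ((σ ^ k) x) m = v x (m + k) := fun x k => by
    induction k with
    | zero => simp
    | succ k ih => intro m; rw [pow_succ', Module.End.mul_apply, hv, ih, add_right_comm, add_assoc]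
  have hnorm : ∀ x N, ‖v ((σ ^ N) x)‖ ^ 2 = ‖v x‖ ^ 2 - ∑ k ∈ Finset.range N, ‖v x k‖ ^ 2 := by
    refine fun x N => (lp.hasSum_norm_sq _).unique ?_
    simp only [hpow]
    exact (hasSum_nat_add_iff' N).2 (lp.hasSum_norm_sq (v x))
  refine ⟨a, ha, ha', fun x => ?_⟩
  have hx := hlim x ?_
  · simpa [hpow] using hx
  · have h0 : Filter.Tendsto (fun N => ‖v ((σ ^ N) x)‖ ^ 2) Filter.atTop (nhds 0) := by
      simp only [hnorm]
      rw [← sub_self (‖v x‖ ^ 2)]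
      exact (lp.hasSum_norm_sq (v x)).tendsto_sum_nat.const_sub (‖v x‖ ^ 2)
    have h1 : Filter.Tendsto (fun N => v ((σ ^ N) x)) Filter.atTop (nhds 0) := by
      rw [tendsto_zero_iff_norm_tendsto_zero]
      simpa [Real.sqrt_sq] using h0.sqrt
    simpa [Function.comp_def] using (b.continuous.tendsto 0).comp h1

theorem memℓp_inner_star_pow {Z : H →L[ℂ] H} (hZ : ‖Z‖ < 1) (g h : H) :
    Memℓp (fun m : ℕ => inner ℂ g ((star Z ^ m) h)) 2 := by
  refine memℓp_gen ?_
  have hZ2 : ‖Z‖ ^ 2 < 1 := pow_lt_one₀ (norm_nonneg _) hZ two_ne_zero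
  refine Summable.of_nonneg_of_le (fun m => by positivity) (fun m => ?_)
    ((summable_geometric_of_lt_one (by positivity) hZ2).mul_right ((‖g‖ * ‖h‖) ^ 2))
  have h1 : ‖(star Z ^ m) h‖ ≤ ‖Z‖ ^ m * ‖h‖ := by
    induction m with
    | zero => simp
    | succ m ih =>
      rw [pow_succ', mul_apply_eq_comp, pow_succ', mul_assoc]
      exact ((star Z).le_of_opNorm_le (norm_star Z).le _).trans (by gcongr)
  have h2 : ‖inner ℂ g ((star Z ^ m) h)‖ ≤ ‖Z‖ ^ m * (‖g‖ * ‖h‖) :=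
    (norm_inner_le_norm _ _).trans
      ((mul_le_mul_of_nonneg_left h1 (norm_nonneg g)).trans_eq (by ring))
  calc ‖inner ℂ g ((star Z ^ m) h)‖ ^ (2 : ENNReal).toReal
      = ‖inner ℂ g ((star Z ^ m) h)‖ ^ 2 := by simp
    _ ≤ (‖Z‖ ^ m * (‖g‖ * ‖h‖)) ^ 2 := by gcongr
    _ = _ := by ring

/-- The square-summable sequence of matrix coefficients `⟪g, (Z*)ᵐ h⟫` of a strict contraction. -/
noncomputable def orbitCoeff {Z : H →L[ℂ] H} (hZ : ‖Z‖ < 1) (g h : H) : lp (fun _ : ℕ => ℂ) 2 :=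
  ⟨fun m => inner ℂ g ((star Z ^ m) h), memℓp_inner_star_pow hZ g h⟩

theorem orbitCoeff_apply {Z : H →L[ℂ] H} (hZ : ‖Z‖ < 1) (g h : H) (m : ℕ) :
    orbitCoeff hZ g h m = inner ℂ g ((star Z ^ m) h) := rfl

theorem orbitCoeff_smul {Z : H →L[ℂ] H} (hZ : ‖Z‖ < 1) (g h : H) (c : ℂ) :
    orbitCoeff hZ g (c • h) = c • orbitCoeff hZ g h := by
  ext m
  simp [orbitCoeff_apply]

theorem inner_apply_eq_inner_orbitCoeff {Z Z' q : H →L[ℂ] H} (hZ : ‖Z‖ < 1) (hZ' : ‖Z'‖ < 1)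
    {g g' : H} (hq : q - Z * q * star Z' = InnerProductSpace.rankOne ℂ g g') (h h' : H) :
    inner ℂ h (q h') = inner ℂ (orbitCoeff hZ g h) (orbitCoeff hZ' g' h') := by
  have hs := hasSum_pow_mul_mul_pow hZ ((norm_star Z').trans_lt hZ') hq
  have hs' := (innerSL ℂ h).hasSum ((ContinuousLinearMap.apply ℂ H h').hasSum hs)
  refine hs'.unique ?_
  convert lp.hasSum_inner (orbitCoeff hZ g h) (orbitCoeff hZ' g' h') using 2 with m
  have hadj : inner ℂ h ((Z ^ m) g) = inner ℂ ((star Z ^ m) h) g := by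
    rw [← star_pow, star_eq_adjoint, adjoint_inner_left]
  change inner ℂ h ((Z ^ m) (inner ℂ g' ((star Z' ^ m) h') • g)) = _
  rw [map_smul, inner_smul_right, hadj, orbitCoeff_apply, orbitCoeff_apply, RCLike.inner_apply,
    inner_conj_symm]

theorem norm_sum_orbitCoeff_le {n : ℕ} {Z W : Fin n → H →L[ℂ] H} (hZ : ∀ i, ‖Z i‖ < 1)
    {Q : Matrix (Fin n) (Fin n) (H →L[ℂ] H) → Matrix (Fin n) (Fin n) (H →L[ℂ] H)}
    (hQ : ∀ x i j, Q x i j - Z i * Q x i j * star (Z j) = x i j)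
    (hcp : CompletelyPositive fun a : Matrix (Fin n) (Fin n) (H →L[ℂ] H) => Q a - PhiMap W (Q a))
    {k : ℕ} (i : Fin k → Fin n) (g h : Fin k → H) :
    ‖∑ s, orbitCoeff (hZ (i s)) (g s) (star (W (i s)) (h s))‖ ≤
      ‖∑ s, orbitCoeff (hZ (i s)) (g s) (h s)‖ := by
  rcases subsingleton_or_nontrivial H with hH | hH
  · exact le_of_eq (congrArg norm (Finset.sum_congr rfl fun s _ => by
      rw [Subsingleton.elim (star (W (i s)) (h s)) (h s)]))
  rcases Nat.eq_zero_or_pos k with rfl | hk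
  · simp
  obtain ⟨e, he⟩ := exists_norm_eq H zero_le_one
  let r₀ : Fin k := ⟨0, hk⟩
  let b : Matrix (Fin k) (Fin k) (Matrix (Fin n) (Fin n) (H →L[ℂ] H)) :=
    Matrix.of fun r t => Matrix.of fun l _ =>
      if r = r₀ then if l = i r₀ then InnerProductSpace.rankOne ℂ e (g t) else 0 else 0
  have hb : ∀ s t p q, (star b * b) s t p q = InnerProductSpace.rankOne ℂ (g s) (g t) := by
    intro s t p q
    have : ∀ r l, star (b r s l p) * b r t l q = if r = r₀ then if l = i r₀ then
        InnerProductSpace.rankOne ℂ (g s) (g t) else 0 else 0 := fun r l => by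
      simp only [b, Matrix.of_apply]
      split_ifs
      · ext x
        simp [star_eq_adjoint, he]
      all_goals simp
    simp [Matrix.mul_apply, Matrix.star_apply, Matrix.sum_apply, this]
  obtain ⟨c, hc⟩ := hcp k hk _ ⟨b, rfl⟩
  have hent : ∀ s t, inner ℂ (h s) ((star c * c) s t (i s) (i t) (h t)) =
      inner ℂ (orbitCoeff (hZ (i s)) (g s) (h s)) (orbitCoeff (hZ (i t)) (g t) (h t)) -
      inner ℂ (orbitCoeff (hZ (i s)) (g s) (star (W (i s)) (h s)))
        (orbitCoeff (hZ (i t)) (g t) (star (W (i t)) (h t))) := fun s t => by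
    have hq := (hQ ((star b * b) s t) (i s) (i t)).trans (hb s t _ _)
    rw [← inner_apply_eq_inner_orbitCoeff _ _ hq, ← inner_apply_eq_inner_orbitCoeff _ _ hq, ← hc]
    simp only [ampl, Matrix.of_apply, Matrix.sub_apply, PhiMap, sub_apply, inner_sub_right,
      comp_apply, star_eq_adjoint, adjoint_inner_left]
  have hpos : 0 ≤ (∑ s, ∑ t, inner ℂ (h s) ((star c * c) s t (i s) (i t) (h t))).re := by
    have : ∑ s, ∑ t, inner ℂ (h s) ((star c * c) s t (i s) (i t) (h t)) =
        ∑ r, ∑ l, inner ℂ (∑ s, c r s l (i s) (h s)) (∑ t, c r t l (i t) (h t)) := by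
      simp only [sum_inner, inner_sum, Matrix.mul_apply, Matrix.star_apply, Matrix.sum_apply,
        sum_apply, mul_apply_eq_comp, star_eq_adjoint, adjoint_inner_right]
      have hrot : ∀ {γ : Type} [Fintype γ] (f : Fin k → Fin k → γ → ℂ),
          ∑ s, ∑ t, ∑ r, f s t r = ∑ r, ∑ s, ∑ t, f s t r := fun f =>
        (Finset.sum_congr rfl fun s _ => Finset.sum_comm).trans Finset.sum_comm
      rw [Finset.sum_comm, hrot]
      exact Finset.sum_congr rfl fun r _ => hrot _
    rw [this, Complex.re_sum]
    refine Finset.sum_nonneg fun r _ => ?_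
    rw [Complex.re_sum]
    exact Finset.sum_nonneg fun l _ => inner_self_nonneg (𝕜 := ℂ)
  simp only [hent, Finset.sum_sub_distrib, ← inner_sum, ← sum_inner] at hpos
  rw [← sq_le_sq₀ (norm_nonneg _) (norm_nonneg _)]
  simpa [inner_self_eq_norm_sq_to_K, ← Complex.ofReal_pow] using hpos

theorem norm_finset_sum_orbitCoeff_le {n : ℕ} {Z W : Fin n → H →L[ℂ] H} (hZ : ∀ i, ‖Z i‖ < 1)
    {Q : Matrix (Fin n) (Fin n) (H →L[ℂ] H) → Matrix (Fin n) (Fin n) (H →L[ℂ] H)}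
    (hQ : ∀ x i j, Q x i j - Z i * Q x i j * star (Z j) = x i j)
    (hcp : CompletelyPositive fun a : Matrix (Fin n) (Fin n) (H →L[ℂ] H) => Q a - PhiMap W (Q a))
    {ι : Type*} (S : Finset ι) (i : ι → Fin n) (g h : ι → H) :
    ‖∑ s ∈ S, orbitCoeff (hZ (i s)) (g s) (star (W (i s)) (h s))‖ ≤
      ‖∑ s ∈ S, orbitCoeff (hZ (i s)) (g s) (h s)‖ := by
  have hsum : ∀ F : ι → lp (fun _ : ℕ => ℂ) 2,
      ∑ s ∈ S, F s = ∑ t : Fin S.card, F (S.equivFin.symm t) := fun F => by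
    rw [Equiv.sum_comp S.equivFin.symm fun s : S => F s, Finset.sum_coe_sort]
  rw [hsum, hsum]
  exact norm_sum_orbitCoeff_le hZ hQ hcp (fun s => i (S.equivFin.symm s))
    (fun s => g (S.equivFin.symm s)) fun s => h (S.equivFin.symm s)

theorem linearCombination_orbitCoeff_shift {ι : Type*} {Z : ι → H →L[ℂ] H} (hZ : ∀ i, ‖Z i‖ < 1)
    (F : ι → H → H) (x : ι × H × H →₀ ℂ) (m : ℕ) :
    Finsupp.linearCombination ℂ (fun p : ι × H × H => orbitCoeff (hZ p.1) p.2.1 (F p.1 p.2.2))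
        (Finsupp.lmapDomain ℂ ℂ (fun p : ι × H × H => (p.1, Z p.1 p.2.1, p.2.2)) x) m =
      Finsupp.linearCombination ℂ (fun p : ι × H × H => orbitCoeff (hZ p.1) p.2.1 (F p.1 p.2.2)) x
        (m + 1) := by
  induction x using Finsupp.induction_linear with
  | zero => simp
  | add x y hx hy =>
    rw [map_add, map_add, map_add, lp.coeFn_add, lp.coeFn_add, Pi.add_apply, Pi.add_apply, hx, hy]
  | single p c =>
    simp only [Finsupp.lmapDomain_apply, Finsupp.mapDomain_single,
      Finsupp.linearCombination_single, lp.coeFn_smul, Pi.smul_apply, orbitCoeff_apply]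
    rw [pow_succ', mul_apply_eq_comp, star_eq_adjoint, adjoint_inner_right]

theorem interpolatesHInfty_of_completelyPositive {n : ℕ} {Z W : Fin n → H →L[ℂ] H}
    (hZ : ∀ i, ‖Z i‖ < 1)
    {Q : Matrix (Fin n) (Fin n) (H →L[ℂ] H) → Matrix (Fin n) (Fin n) (H →L[ℂ] H)}
    (hQ : ∀ x i j, Q x i j - Z i * Q x i j * star (Z j) = x i j)
    (hcp : CompletelyPositive fun a : Matrix (Fin n) (Fin n) (H →L[ℂ] H) => Q a - PhiMap W (Q a)) :
    InterpolatesHInfty Z W := by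
  obtain ⟨a, ha, ha', hlim⟩ := exists_schur_coeff_of_shift_dominated
    (Finsupp.linearCombination ℂ fun p : Fin n × H × H => orbitCoeff (hZ p.1) p.2.1 p.2.2)
    (Finsupp.linearCombination ℂ fun p : Fin n × H × H =>
      orbitCoeff (hZ p.1) p.2.1 (star (W p.1) p.2.2))
    (Finsupp.lmapDomain ℂ ℂ fun p : Fin n × H × H => (p.1, Z p.1 p.2.1, p.2.2))
    (linearCombination_orbitCoeff_shift hZ fun _ h => h)
    (linearCombination_orbitCoeff_shift hZ fun i h => star (W i) h) fun x => by
      simp only [Finsupp.linearCombination_apply, Finsupp.sum, ← orbitCoeff_smul, ← map_smul]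
      exact norm_finset_sum_orbitCoeff_le hZ hQ hcp x.support (fun p => p.1) (fun p => p.2.1)
        fun p => x p • p.2.2
  have hconj : ∀ k, ‖star (a k)‖ ≤ 1 := fun k => (norm_star _).le.trans (ha k)
  refine ⟨fun k => star (a k), fun z hz => ⟨summable_mul_pow_of_norm_le_one hconj hz, ?_⟩,
    fun i => ?_⟩
  · have h := ha' (star z) ((norm_star z).trans_lt hz)
    rwa [← norm_star, tsum_star, tsum_congr fun k => by rw [star_mul', star_pow, star_star]]
      at h
  · have hZ' : ‖star (Z i)‖ < 1 := (norm_star _).trans_lt (hZ i)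
    have hs : Summable fun k => a k • star (Z i) ^ k :=
      Summable.of_norm_bounded (summable_norm_geometric_of_norm_lt_one hZ') fun k => by
        rw [norm_smul]
        exact mul_le_of_le_one_left (norm_nonneg _) (ha k)
    have heq : ∑' k, a k • star (Z i) ^ k = star (W i) := by
      refine ContinuousLinearMap.ext fun h => ext_inner_left ℂ fun g => ?_
      have h1 := ((innerSL ℂ g).hasSum ((apply ℂ H h).hasSum hs.hasSum)).tendsto_sum_nat
      refine tendsto_nhds_unique h1 ?_
      have h2 := hlim (Finsupp.single (i, g, h) 1)
      simpa [orbitCoeff_apply, inner_smul_right] using h2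
    have := (heq ▸ hs.hasSum).star
    simpa only [star_smul, star_pow, star_star] using this

theorem interpolation_iff_pick_map_completelyPositive
    {n : ℕ} (hn : 1 ≤ n) (Z W : Fin n → H →L[ℂ] H)
    (hZdistinct : Function.Injective Z) (hZ : ∀ i, ‖Z i‖ < 1) :
    (∃ C : ℝ, C < 1 ∧ ∀ a : Matrix (Fin n) (Fin n) (H →L[ℂ] H),
        ‖toOp (PhiMap Z a)‖ ≤ C * ‖toOp a‖) ∧
      Function.Bijective
        (fun a : Matrix (Fin n) (Fin n) (H →L[ℂ] H) => a - PhiMap Z a) ∧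
      ∀ Q : Matrix (Fin n) (Fin n) (H →L[ℂ] H) → Matrix (Fin n) (Fin n) (H →L[ℂ] H),
        Function.LeftInverse Q (fun a => a - PhiMap Z a) →
        Function.RightInverse Q (fun a => a - PhiMap Z a) →
        (InterpolatesHInfty Z W ↔
          CompletelyPositive (fun a : Matrix (Fin n) (Fin n) (H →L[ℂ] H) =>
            Q a - PhiMap W (Q a))) := by
  refine ⟨exists_norm_toOp_phiMap_le hZ, bijective_sub_phiMap hZ, fun Q _ hQ => ?_⟩
  have hQ' : ∀ x i j, Q x i j - Z i * Q x i j * star (Z j) = x i j := fun x i j =>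
    congrFun (congrFun (hQ x) i) j
  exact ⟨fun hf => completelyPositive_of_interpolatesHInfty hZ hf hQ',
    interpolatesHInfty_of_completelyPositive hZ hQ'⟩
end

section
/- Let n ≥ 1, let z₁,…,zₙ be pairwise distinct complex numbers with |zᵢ| < 1, and let w₁,…,wₙ ∈ ℂ. Then there exists a function f : ℂ → ℂ that is differentiable on the open unit ball Metric.ball (0 : ℂ) 1, satisfies |f z| ≤ 1 for every z in that ball, and satisfies f zᵢ = wᵢ for each i, if and only if the n×n Pick matrix with (i,j) entry (1 − wᵢ·conj(wⱼ)) / (1 − zᵢ·conj(zⱼ)) is positive semidefinite (Matrix.PosSemidef). -/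
open scoped ComplexOrder

/-!
STATEMENT 4: Let n ≥ 1, let z₁,…,zₙ be pairwise distinct complex numbers with |zᵢ| < 1, and
let w₁,…,wₙ ∈ ℂ.  Then there exists a function f : ℂ → ℂ that is differentiable on the open
unit ball, satisfies |f z| ≤ 1 on that ball, and f zᵢ = wᵢ for each i, if and only if the
Pick matrix with (i,j) entry (1 − wᵢ·conj(wⱼ)) / (1 − zᵢ·conj(zⱼ)) is positive semidefinite.
-/

open scoped ComplexConjugate
open Metric Set

/-- The disc automorphism sending `a` to `0`. -/
noncomputable def discMobius (a w : ℂ) : ℂ := (w - a) / (1 - conj a * w)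

/-- The Pick matrix of the interpolation data `z i ↦ w i`. -/
noncomputable def pickMatrix {ι : Type*} (z w : ι → ℂ) : Matrix ι ι ℂ :=
  Matrix.of fun i j => (1 - w i * conj (w j)) / (1 - z i * conj (z j))

/-- Solvability of the interpolation problem `z i ↦ w i` in the closed unit ball of `H^∞`. -/
def HasSchurInterpolant {ι : Type*} (z w : ι → ℂ) : Prop :=
  ∃ f : ℂ → ℂ, DifferentiableOn ℂ f (ball (0 : ℂ) 1) ∧
    (∀ x ∈ ball (0 : ℂ) 1, ‖f x‖ ≤ 1) ∧ ∀ i, f (z i) = w i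

theorem one_sub_conj_mul_ne_zero {a w : ℂ} (ha : ‖a‖ < 1) (hw : ‖w‖ ≤ 1) :
    1 - conj a * w ≠ 0 := by
  intro h
  have h1 : ‖conj a * w‖ = 1 := by rw [← sub_eq_zero.mp h, norm_one]
  rw [norm_mul, RCLike.norm_conj] at h1
  nlinarith [norm_nonneg a, norm_nonneg w]

theorem norm_one_sub_conj_mul_sq_sub (a w : ℂ) :
    ‖1 - conj a * w‖ ^ 2 - ‖w - a‖ ^ 2 = (1 - ‖a‖ ^ 2) * (1 - ‖w‖ ^ 2) := by
  simp only [← Complex.normSq_eq_norm_sq, Complex.normSq_apply, Complex.sub_re, Complex.sub_im,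
    Complex.mul_re, Complex.mul_im, Complex.conj_re, Complex.conj_im, Complex.one_re,
    Complex.one_im]
  ring

theorem norm_discMobius_le_one {a w : ℂ} (ha : ‖a‖ < 1) (hw : ‖w‖ ≤ 1) :
    ‖discMobius a w‖ ≤ 1 := by
  rw [discMobius, norm_div]
  refine div_le_one_of_le₀ (abs_le_of_sq_le_sq' ?_ (norm_nonneg _)).2 (norm_nonneg _)
  have : 0 ≤ (1 - ‖a‖ ^ 2) * (1 - ‖w‖ ^ 2) :=
    mul_nonneg (by nlinarith [norm_nonneg a]) (by nlinarith [norm_nonneg w])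
  linarith [norm_one_sub_conj_mul_sq_sub a w]

theorem norm_discMobius_lt_one {a w : ℂ} (ha : ‖a‖ < 1) (hw : ‖w‖ < 1) :
    ‖discMobius a w‖ < 1 := by
  rw [discMobius, norm_div,
    div_lt_one (norm_pos_iff.mpr (one_sub_conj_mul_ne_zero ha hw.le))]
  refine lt_of_pow_lt_pow_left₀ 2 (norm_nonneg _) ?_
  have : 0 < (1 - ‖a‖ ^ 2) * (1 - ‖w‖ ^ 2) :=
    mul_pos (by nlinarith [norm_nonneg a]) (by nlinarith [norm_nonneg w])
  linarith [norm_one_sub_conj_mul_sq_sub a w]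

theorem one_sub_conj_mul_self_ne_zero {a : ℂ} (ha : ‖a‖ < 1) : 1 - conj a * a ≠ 0 :=
  one_sub_conj_mul_ne_zero ha ha.le

theorem discMobius_neg_discMobius {a w : ℂ} (ha : ‖a‖ < 1) (hw : ‖w‖ ≤ 1) :
    discMobius (-a) (discMobius a w) = w := by
  have h1 := one_sub_conj_mul_ne_zero ha hw
  have h2 : 1 - conj (-a) * discMobius a w ≠ 0 :=
    one_sub_conj_mul_ne_zero (by rwa [norm_neg]) (norm_discMobius_le_one ha hw)
  rw [discMobius, div_eq_iff h2, discMobius, map_neg]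
  linear_combination div_mul_cancel₀ (w - a) h1

@[simp]
theorem discMobius_self (a : ℂ) : discMobius a a = 0 := by simp [discMobius]

theorem discMobius_ne_zero {a w : ℂ} (ha : ‖a‖ < 1) (hw : ‖w‖ ≤ 1) (hne : w ≠ a) :
    discMobius a w ≠ 0 :=
  div_ne_zero (sub_ne_zero.mpr hne) (one_sub_conj_mul_ne_zero ha hw)

theorem DifferentiableOn.discMobius {a : ℂ} (ha : ‖a‖ < 1) {f : ℂ → ℂ} {s : Set ℂ}
    (hf : DifferentiableOn ℂ f s) (hs : ∀ x ∈ s, ‖f x‖ ≤ 1) :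
    DifferentiableOn ℂ (fun x => discMobius a (f x)) s :=
  (hf.sub_const a).div ((hf.const_mul _).const_sub 1) fun x hx =>
    one_sub_conj_mul_ne_zero ha (hs x hx)

theorem mapsTo_discMobius_ball {a : ℂ} (ha : ‖a‖ < 1) :
    MapsTo (discMobius a) (ball 0 1) (ball 0 1) := fun x hx => by
  rw [mem_ball_zero_iff] at hx ⊢
  exact norm_discMobius_lt_one ha hx

/-- One step of the Schur algorithm. -/
theorem hasSchurInterpolant_iff_schurStep {n : ℕ} {z w : Fin (n + 1) → ℂ}
    (hz : ∀ i, ‖z i‖ < 1) (hinj : Function.Injective z) (hw0 : ‖w 0‖ < 1)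
    (hw : ∀ i, ‖w i‖ ≤ 1) :
    HasSchurInterpolant z w ↔ HasSchurInterpolant (fun i : Fin n => z i.succ)
      (fun i : Fin n => discMobius (w 0) (w i.succ) / discMobius (z 0) (z i.succ)) := by
  have hz0 : ‖-z 0‖ < 1 := by simpa using hz 0
  have hw0' : ‖-w 0‖ < 1 := by simpa using hw0
  have hb (i : Fin n) : discMobius (z 0) (z i.succ) ≠ 0 :=
    discMobius_ne_zero (hz 0) (hz _).le fun h => Fin.succ_ne_zero i (hinj h)
  have hdb : DifferentiableOn ℂ (discMobius (z 0)) (ball 0 1) :=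
    differentiableOn_id.discMobius (hz 0) fun x hx => (mem_ball_zero_iff.mp hx).le
  constructor
  · rintro ⟨f, hfd, hfb, hfz⟩
    set F : ℂ → ℂ := fun u => discMobius (w 0) (f (discMobius (-z 0) u)) with hF
    have hF0 : F 0 = 0 := by simp [hF, discMobius, hfz]
    have hmaps := mapsTo_discMobius_ball hz0
    have hFd : DifferentiableOn ℂ F (ball 0 1) :=
      (hfd.comp (differentiableOn_id.discMobius hz0 fun x hx => (mem_ball_zero_iff.mp hx).le)
        hmaps).discMobius hw0 fun x hx => hfb _ (hmaps hx)
    have hFb : MapsTo F (ball 0 1) (closedBall (F 0) 1) := fun x hx => by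
      rw [hF0, mem_closedBall_zero_iff]
      exact norm_discMobius_le_one hw0 (hfb _ (hmaps hx))
    refine ⟨fun x => dslope F 0 (discMobius (z 0) x), ?_, fun x hx => ?_, fun i => ?_⟩
    · exact ((Complex.differentiableOn_dslope (ball_mem_nhds 0 one_pos)).mpr hFd).comp hdb
        (mapsTo_discMobius_ball (hz 0))
    · simpa using Complex.norm_dslope_le_div_of_mapsTo_ball hFd hFb
        (mapsTo_discMobius_ball (hz 0) hx)
    · simp only [dslope_of_ne _ (hb i), slope_def_field, hF0, sub_zero]
      simp only [hF, discMobius_neg_discMobius (hz 0) (hz i.succ).le, hfz]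
  · rintro ⟨g, hgd, hgb, hgz⟩
    have hbd : ∀ x ∈ ball (0 : ℂ) 1, ‖discMobius (z 0) x * g x‖ ≤ 1 := fun x hx => by
      rw [norm_mul]
      exact mul_le_one₀ (norm_discMobius_le_one (hz 0) (mem_ball_zero_iff.mp hx).le)
        (norm_nonneg _) (hgb x hx)
    refine ⟨fun x => discMobius (-w 0) (discMobius (z 0) x * g x),
      (hdb.mul hgd).discMobius hw0' hbd,
      fun x hx => norm_discMobius_le_one hw0' (hbd x hx), fun i => ?_⟩
    refine Fin.cases ?_ (fun i => ?_) i
    · simp [discMobius]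
    · simp only [hgz]
      rw [mul_div_cancel₀ _ (hb i), discMobius_neg_discMobius hw0 (hw _)]

theorem isHermitian_pickMatrix {ι : Type*} (z w : ι → ℂ) : (pickMatrix z w).IsHermitian := by
  ext i j
  simp [pickMatrix, mul_comm]

theorem one_sub_mul_conj_self (a : ℂ) : 1 - a * conj a = ((1 - ‖a‖ ^ 2 : ℝ) : ℂ) := by
  rw [Complex.mul_conj, Complex.normSq_eq_norm_sq]
  push_cast
  rfl

theorem norm_le_one_of_posSemidef_pickMatrix {ι : Type*} {z w : ι → ℂ}
    (hz : ∀ i, ‖z i‖ < 1) (h : (pickMatrix z w).PosSemidef) (i : ι) : ‖w i‖ ≤ 1 := by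
  have h1 := h.diag_nonneg (i := i)
  simp only [pickMatrix, Matrix.of_apply, one_sub_mul_conj_self] at h1
  rw [← Complex.ofReal_div, Complex.zero_le_real] at h1
  have h2 : 0 < 1 - ‖z i‖ ^ 2 := by nlinarith [norm_nonneg (z i), hz i]
  have h3 := (le_div_iff₀ h2).mp h1
  nlinarith [norm_nonneg (w i)]

theorem Matrix.PosSemidef.apply_eq_zero_of_diag {ι : Type*} {A : Matrix ι ι ℂ}
    (hA : A.PosSemidef) {i : ι} (hi : A i i = 0) (j : ι) : A j i = 0 := by
  have h := (hA.submatrix ![i, j]).det_nonneg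
  rw [Matrix.det_fin_two] at h
  simp only [Matrix.submatrix_apply, Matrix.cons_val_zero, Matrix.cons_val_one, hi, zero_mul,
    zero_sub] at h
  rw [← hA.1.apply i j, Complex.star_def, mul_comm, Complex.mul_conj, ← Complex.ofReal_neg,
    Complex.zero_le_real] at h
  exact Complex.normSq_eq_zero.mp (le_antisymm (by linarith) (Complex.normSq_nonneg _))

/-- The Schur complement computation behind the Schur algorithm, with conjugates as independent
variables. -/
theorem pick_schurComplement_entry {K : Type*} [Field K] {a a' b b' x y u v : K}
    (ha : 1 - a' * a ≠ 0) (hb : 1 - b' * b ≠ 0) (hxa : 1 - a' * x ≠ 0) (hay : 1 - a * y ≠ 0)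
    (hxy : 1 - x * y ≠ 0) (hub : 1 - b' * u ≠ 0) (hbv : 1 - b * v ≠ 0) (hx : x - a ≠ 0)
    (hy : y - a' ≠ 0) :
    (1 - u * v) / (1 - x * y) -
        (1 - b' * u) / (1 - a' * x) * ((1 - b' * b) / (1 - a' * a))⁻¹ *
          ((1 - b * v) / (1 - a * y)) =
      ((1 - b' * u) * ((x - a) / (1 - a' * x))) *
        ((1 - (u - b) / (1 - b' * u) / ((x - a) / (1 - a' * x)) *
          ((v - b') / (1 - b * v) / ((y - a') / (1 - a * y)))) / (1 - x * y)) *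
        ((1 - b * v) * ((y - a') / (1 - a * y))) / (1 - b' * b) := by
  generalize hp : 1 - a' * a = p at *
  generalize hq : 1 - b' * b = q at *
  generalize hr : 1 - a' * x = r at *
  generalize hs : 1 - a * y = s at *
  generalize ht : 1 - x * y = t at *
  generalize hl : 1 - b' * u = l at *
  generalize hm : 1 - b * v = m at *
  field_simp
  subst hp hq hr hs ht hl hm
  ring

/-- One step of the Schur algorithm takes the Pick matrix, up to congruence, to its Schur
complement. -/
theorem posSemidef_pickMatrix_iff_schurStep {n : ℕ} {z w : Fin (n + 1) → ℂ}
    (hz : ∀ i, ‖z i‖ < 1) (hinj : Function.Injective z) (hw0 : ‖w 0‖ < 1)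
    (hw : ∀ i, ‖w i‖ ≤ 1) :
    (pickMatrix z w).PosSemidef ↔ (pickMatrix (fun i : Fin n => z i.succ)
      (fun i : Fin n => discMobius (w 0) (w i.succ) / discMobius (z 0) (z i.succ))).PosSemidef := by
  have hb (i : Fin n) : discMobius (z 0) (z i.succ) ≠ 0 :=
    discMobius_ne_zero (hz 0) (hz _).le fun h => Fin.succ_ne_zero i (hinj h)
  have hwc : 0 < 1 - ‖w 0‖ ^ 2 := by nlinarith [norm_nonneg (w 0)]
  have hzc : 0 < 1 - ‖z 0‖ ^ 2 := by nlinarith [norm_nonneg (z 0), hz 0]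
  set s : ℝ := Real.sqrt (1 - ‖w 0‖ ^ 2)
  have hs0 : (s : ℂ) ≠ 0 := Complex.ofReal_ne_zero.mpr (Real.sqrt_ne_zero'.mpr hwc)
  have hss : (s : ℂ) * s = 1 - conj (w 0) * w 0 := by
    rw [← Complex.ofReal_mul, Real.mul_self_sqrt hwc.le, mul_comm, one_sub_mul_conj_self]
  set A : Matrix Unit Unit ℂ := Matrix.diagonal fun _ => pickMatrix z w 0 0 with hAdef
  have hA : A.PosDef := by
    refine Matrix.PosDef.diagonal fun _ => ?_
    simp only [pickMatrix, Matrix.of_apply, one_sub_mul_conj_self]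
    rw [← Complex.ofReal_div, Complex.zero_lt_real]
    exact div_pos hwc hzc
  let _ := hA.isUnit.invertible
  set B : Matrix Unit (Fin n) ℂ := Matrix.of fun _ j => pickMatrix z w 0 j.succ with hB
  let e : Unit ⊕ Fin n ≃ Fin (n + 1) :=
    ((Equiv.sumComm _ _).trans (Equiv.optionEquivSumPUnit _).symm).trans (finSuccEquiv n).symm
  have hblocks : (pickMatrix z w).submatrix e e =
      Matrix.fromBlocks A B B.conjTranspose ((pickMatrix z w).submatrix Fin.succ Fin.succ) := by
    ext (i | i) (j | j)
    · simp [e, hAdef]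
    · simp [e, hB]
    · simp [e, hB, ← (isHermitian_pickMatrix z w).apply i.succ 0]
    · simp [e]
  set d : Fin n → ℂ := fun i =>
    (1 - conj (w 0) * w i.succ) * discMobius (z 0) (z i.succ) / s with hd
  have hdu : IsUnit (Matrix.diagonal d) := by
    rw [Matrix.isUnit_diagonal, Pi.isUnit_iff]
    exact fun i => (div_ne_zero (mul_ne_zero (one_sub_conj_mul_ne_zero hw0 (hw _)) (hb i))
      hs0).isUnit
  rw [← Matrix.posSemidef_submatrix_equiv e, hblocks, Matrix.PosDef.fromBlocks₁₁ _ _ hA,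
    ← Matrix.IsUnit.posSemidef_star_right_conjugate_iff (x := pickMatrix _ _) hdu]
  congr! 1
  ext i j
  have hconj {a x : ℂ} (ha : ‖a‖ < 1) (hx : ‖x‖ ≤ 1) : 1 - a * conj x ≠ 0 := by
    simpa using one_sub_conj_mul_ne_zero (a := conj a) (w := conj x) (by simpa) (by simpa)
  have hne (i : Fin n) : z i.succ - z 0 ≠ 0 :=
    sub_ne_zero.mpr fun h => Fin.succ_ne_zero i (hinj h)
  have key := pick_schurComplement_entry (one_sub_conj_mul_self_ne_zero (hz 0))
    (one_sub_conj_mul_self_ne_zero hw0) (one_sub_conj_mul_ne_zero (hz 0) (hz i.succ).le)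
    (hconj (hz 0) (hz j.succ).le) (hconj (hz i.succ) (hz j.succ).le)
    (one_sub_conj_mul_ne_zero hw0 (hw i.succ)) (hconj hw0 (hw j.succ)) (hne i)
    (y := conj (z j.succ)) (by simpa using (map_ne_zero conj).mpr (hne j))
  rw [← hss] at key
  have hL : (B.conjTranspose * A⁻¹ * B) i j = (1 - conj (w 0) * w i.succ) /
      (1 - conj (z 0) * z i.succ) * ((1 - conj (w 0) * w 0) / (1 - conj (z 0) * z 0))⁻¹ *
      ((1 - w 0 * conj (w j.succ)) / (1 - z 0 * conj (z j.succ))) := by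
    simp [hAdef, hB, Matrix.mul_apply, pickMatrix, mul_comm]
  rw [Matrix.sub_apply, hL, ← hss, Matrix.star_eq_conjTranspose, Matrix.diagonal_conjTranspose,
    Matrix.mul_diagonal, Matrix.diagonal_mul]
  simp only [Matrix.submatrix_apply, pickMatrix, Matrix.of_apply]
  rw [key]
  simp only [hd, discMobius, Pi.star_apply, Complex.star_def, map_div₀, map_mul, map_sub, map_one,
    Complex.conj_conj, Complex.conj_ofReal]
  ring

theorem hasSchurInterpolant_iff_of_norm_eq_one {ι : Type*} {z w : ι → ℂ}
    (hz : ∀ i, ‖z i‖ < 1) {i : ι} (hi : ‖w i‖ = 1) :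
    HasSchurInterpolant z w ↔ ∀ j, w j = w i := by
  constructor
  · rintro ⟨f, hfd, hfb, hfz⟩ j
    have hmem (k : ι) : z k ∈ ball (0 : ℂ) 1 := mem_ball_zero_iff.mpr (hz k)
    have := Complex.eqOn_of_isPreconnected_of_isMaxOn_norm
      (convex_ball (0 : ℂ) 1).isPreconnected isOpen_ball hfd (hmem i)
      (fun x hx => by simpa [hfz, hi] using hfb x hx) (hmem j)
    simpa [hfz] using this
  · exact fun h => ⟨fun _ => w i, differentiableOn_const _, fun _ _ => hi.le, fun j => (h j).symm⟩

theorem posSemidef_pickMatrix_iff_of_norm_eq_one {ι : Type*} {z w : ι → ℂ}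
    (hz : ∀ i, ‖z i‖ < 1) {i : ι} (hi : ‖w i‖ = 1) :
    (pickMatrix z w).PosSemidef ↔ ∀ j, w j = w i := by
  have hwi : w i * conj (w i) = 1 := by
    rw [Complex.mul_conj, Complex.normSq_eq_norm_sq, hi]; simp
  constructor
  · intro h j
    have h1 := h.apply_eq_zero_of_diag (i := i) (by simp [pickMatrix, hwi]) j
    have h2 : 1 - z j * conj (z i) ≠ 0 := by
      rw [mul_comm]; exact one_sub_conj_mul_ne_zero (hz i) (hz j).le
    have h3 : w j * conj (w i) = 1 := by
      simp only [pickMatrix, Matrix.of_apply, div_eq_zero_iff, h2, or_false] at h1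
      exact (sub_eq_zero.mp h1).symm
    linear_combination w i * h3 - w j * hwi
  · intro h
    convert Matrix.PosSemidef.zero using 1
    ext j k
    simp [pickMatrix, h j, h k, hwi]

theorem hasSchurInterpolant_iff_posSemidef_pickMatrix {n : ℕ} (z w : Fin n → ℂ)
    (hz : ∀ i, ‖z i‖ < 1) (hinj : Function.Injective z) :
    HasSchurInterpolant z w ↔ (pickMatrix z w).PosSemidef := by
  induction n with
  | zero =>
    refine iff_of_true ⟨0, differentiableOn_const 0, by simp, fun i => i.elim0⟩ ?_
    convert Matrix.PosSemidef.zero using 1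
    exact Subsingleton.elim _ _
  | succ n ih =>
    by_cases hw : ∀ i, ‖w i‖ ≤ 1
    · rcases (hw 0).lt_or_eq with hw0 | hw0
      · rw [hasSchurInterpolant_iff_schurStep hz hinj hw0 hw,
          posSemidef_pickMatrix_iff_schurStep hz hinj hw0 hw]
        exact ih _ _ (fun i => hz _) (hinj.comp (Fin.succ_injective n))
      · rw [hasSchurInterpolant_iff_of_norm_eq_one hz hw0,
          posSemidef_pickMatrix_iff_of_norm_eq_one hz hw0]
    · refine iff_of_false (fun ⟨f, _, hfb, hfz⟩ => hw fun i => ?_)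
        fun h => hw (norm_le_one_of_posSemidef_pickMatrix hz h)
      rw [← hfz]
      exact hfb _ (mem_ball_zero_iff.mpr (hz i))

theorem nevanlinna_pick_interpolation
    {n : ℕ} (hn : 1 ≤ n) (z w : Fin n → ℂ)
    (hz : ∀ i, ‖z i‖ < 1) (hinj : Function.Injective z) :
    (∃ f : ℂ → ℂ, DifferentiableOn ℂ f (Metric.ball (0 : ℂ) 1) ∧
        (∀ x ∈ Metric.ball (0 : ℂ) 1, ‖f x‖ ≤ 1) ∧
        (∀ i, f (z i) = w i)) ↔
      (Matrix.of fun i j : Fin n =>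
          (1 - w i * (starRingEnd ℂ) (w j)) / (1 - z i * (starRingEnd ℂ) (z j))).PosSemidef :=
  hasSchurInterpolant_iff_posSemidef_pickMatrix z w hz hinj
end

section
/- Let G and H be complex Hilbert spaces, let n ≥ 1, for each i ∈ Fin n let 𝒞ᵢ be a set of bounded linear operators from G to H, and let W₁,…,Wₙ ∈ B(H). Let M be the closure of the linear span of {c* h : i ∈ Fin n, c ∈ 𝒞ᵢ, h ∈ H} in G. Then the following are equivalent: (1) there exists a bounded linear map R : M → G with ‖R‖ ≤ 1 such that R (c* h) = c* ((Wᵢ)* h) for every i ∈ Fin n, every c ∈ 𝒞ᵢ and every h ∈ H; (2) for every integer m ≥ 1, every function l : Fin m → Fin n, and every choice of operators cⱼ ∈ 𝒞_{l(j)} (j = 1,…,m), the operator matrix inequality (W_{l(i)} ∘ cᵢ ∘ (cⱼ)* ∘ (W_{l(j)})*)_{i,j} ≤ (cᵢ ∘ (cⱼ)*)_{i,j} holds in CStarMatrix (Fin m) (Fin m) (H →L[ℂ] H). Moreover, condition (2) is equivalent to: for every m, l, cⱼ ∈ 𝒞_{l(j)} and h₁,…,h_m ∈ H, ‖∑ⱼ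 (cⱼ)* ((W_{l(j)})* hⱼ)‖ ≤ ‖∑ⱼ (cⱼ)* hⱼ‖. -/
/-!
STATEMENT 12: Let G and H be complex Hilbert spaces, let n ≥ 1, for each i ∈ Fin n let 𝒞ᵢ be
a set of bounded linear operators from G to H, and let W₁,…,Wₙ ∈ B(H).  Let M be the closure
of the linear span of {c* h : i ∈ Fin n, c ∈ 𝒞ᵢ, h ∈ H} in G.  Then the following are
equivalent: (1) there exists a bounded linear map R : M → G with ‖R‖ ≤ 1 such that
R (c* h) = c* ((Wᵢ)* h) for every i ∈ Fin n, every c ∈ 𝒞ᵢ and every h ∈ H; (2) for every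
integer m ≥ 1, every function l : Fin m → Fin n, and every choice of operators cⱼ ∈ 𝒞_{l(j)},
the operator matrix inequality (W_{l(i)} ∘ cᵢ ∘ (cⱼ)* ∘ (W_{l(j)})*)_{i,j} ≤ (cᵢ ∘ (cⱼ)*)_{i,j}
holds in M_m(B(H)).  Moreover, (2) is equivalent to: for every m, l, cⱼ ∈ 𝒞_{l(j)} and
h₁,…,h_m ∈ H, ‖∑ⱼ (cⱼ)* ((W_{l(j)})* hⱼ)‖ ≤ ‖∑ⱼ (cⱼ)* hⱼ‖.

The C*-order on the operator matrix algebra `Matrix (Fin m) (Fin m) (H →L[ℂ] H)` is expressed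
by the characterization `0 ≤ a ↔ ∃ b, a = star b * b`.
-/

open ContinuousLinearMap

variable {G H : Type*} [NormedAddCommGroup G] [InnerProductSpace ℂ G] [CompleteSpace G]
  [NormedAddCommGroup H] [InnerProductSpace ℂ H] [CompleteSpace H]

/-- The set of generators `{c* h : i ∈ Fin n, c ∈ 𝒞ᵢ, h ∈ H}`. -/
def genSet {n : ℕ} (𝒞 : Fin n → Set (G →L[ℂ] H)) : Set G :=
  {x : G | ∃ i : Fin n, ∃ c ∈ 𝒞 i, ∃ h : H, x = ContinuousLinearMap.adjoint c h}

/-- `M`, the closed linear span of the generators `c* h`. -/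
noncomputable def genSubspace {n : ℕ} (𝒞 : Fin n → Set (G →L[ℂ] H)) : Submodule ℂ G :=
  (Submodule.span ℂ (genSet 𝒞)).topologicalClosure

section

variable {ι : Type*} [Fintype ι]

lemma exists_gram_sub_eq {A B : H →L[ℂ] G} (h : ∀ v, ‖B v‖ ≤ ‖A v‖) :
    ∃ S : H →L[ℂ] H, adjoint A ∘L A - adjoint B ∘L B = adjoint S ∘L S := by
  refine CStarAlgebra.nonneg_iff_eq_star_mul_self.mp ?_
  rw [nonneg_iff_isPositive, isPositive_iff_complex]
  intro v
  have : inner ℂ ((adjoint A ∘L A - adjoint B ∘L B) v) v = ((‖A v‖ ^ 2 - ‖B v‖ ^ 2 : ℝ) : ℂ) := by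
    simp [adjoint_inner_left, inner_self_eq_norm_sq_to_K]
  rw [this]
  refine ⟨by simp [-Complex.ofReal_sub], ?_⟩
  simpa [-Complex.ofReal_sub] using pow_le_pow_left₀ (norm_nonneg _) (h v) 2

lemma inner_sum_apply_self (A : ι → H →L[ℂ] G) (h : ι → H) :
    inner ℂ (∑ i, A i (h i)) (∑ j, A j (h j)) =
      ∑ i, ∑ j, inner ℂ (h i) ((adjoint (A i) ∘L A j) (h j)) := by
  rw [sum_inner]
  simp only [inner_sum, comp_apply, adjoint_inner_right]

lemma adjoint_proj_apply [DecidableEq ι] (j : ι) (x : H) :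
    adjoint (PiLp.proj (𝕜 := ℂ) 2 (fun _ : ι => H) j) x = PiLp.single 2 j x := by
  refine ext_inner_left ℂ fun v => ?_
  simp [adjoint_inner_right, PiLp.inner_apply, apply_ite (inner ℂ _)]

lemma sum_adjoint_proj_comp_proj :
    ∑ k, adjoint (PiLp.proj (𝕜 := ℂ) 2 (fun _ : ι => H) k) ∘L PiLp.proj 2 (fun _ : ι => H) k =
      ContinuousLinearMap.id ℂ (PiLp 2 fun _ : ι => H) := by
  ext1 v
  refine ext_inner_left ℂ fun w => ?_
  simp [sum_apply, inner_sum, adjoint_inner_right, PiLp.inner_apply]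

lemma sum_comp_proj_comp_adjoint_proj {E : Type*} [NormedAddCommGroup E] [InnerProductSpace ℂ E]
    (A : ι → H →L[ℂ] E) (j : ι) :
    (∑ k, A k ∘L PiLp.proj 2 (fun _ : ι => H) k) ∘L
      adjoint (PiLp.proj (𝕜 := ℂ) 2 (fun _ : ι => H) j) = A j := by
  classical
  ext x
  simp [sum_apply, adjoint_proj_apply, apply_ite (A _)]

/-- Domination of Gram operator matrices is domination of the norms of the row operators. -/
lemma starLE_gram_iff (A B : ι → H →L[ℂ] G) :
    StarLE (Matrix.of fun i j => adjoint (B i) ∘L B j)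
        (Matrix.of fun i j => adjoint (A i) ∘L A j) ↔
      ∀ h : ι → H, ‖∑ j, B j (h j)‖ ≤ ‖∑ j, A j (h j)‖ := by
  constructor
  · rintro ⟨b, hb⟩ h
    have entry (i j : ι) : adjoint (A i) ∘L A j =
        adjoint (B i) ∘L B j + ∑ k, adjoint (b k i) ∘L b k j := by
      rw [← sub_eq_iff_eq_add']
      simpa [Matrix.mul_apply, Matrix.star_apply, star_eq_adjoint, mul_def]
        using congrFun (congrFun hb i) j
    have key : inner ℂ (∑ j, A j (h j)) (∑ j, A j (h j)) =
        inner ℂ (∑ j, B j (h j)) (∑ j, B j (h j)) +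
          ∑ k, inner ℂ (∑ j, b k j (h j)) (∑ j, b k j (h j)) := by
      simp only [inner_sum_apply_self]
      rw [Finset.sum_comm (s := Finset.univ (α := ι)) (t := Finset.univ) (f := fun k i => ∑ j, _)]
      simp only [entry, add_apply, sum_apply, inner_add_right, inner_sum, Finset.sum_add_distrib]
      refine congrArg _ (Finset.sum_congr rfl fun i _ => Finset.sum_comm)
    refine le_of_sq_le_sq ?_ (norm_nonneg _)
    have key' := congrArg RCLike.re key
    simp only [map_add, map_sum, inner_self_eq_norm_sq] at key'
    rw [key']
    exact le_add_of_nonneg_right (Finset.sum_nonneg fun _ _ => sq_nonneg _)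
  · intro h
    let P := fun k => PiLp.proj (𝕜 := ℂ) 2 (fun _ : ι => H) k
    let SA := ∑ k, A k ∘L P k
    let SB := ∑ k, B k ∘L P k
    obtain ⟨S, hS⟩ := exists_gram_sub_eq (A := SA) (B := SB) fun v => by
      simpa [SA, SB, P, sum_apply] using h v
    refine ⟨Matrix.of fun k j => P k ∘L S ∘L adjoint (P j), ?_⟩
    ext1 i j
    have hA (j : ι) : SA ∘L adjoint (P j) = A j := sum_comp_proj_comp_adjoint_proj A j
    have hB (j : ι) : SB ∘L adjoint (P j) = B j := sum_comp_proj_comp_adjoint_proj B j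
    have hP1 : ∑ k, adjoint (P k) ∘L P k = ContinuousLinearMap.id ℂ _ :=
      sum_adjoint_proj_comp_proj
    calc adjoint (A i) ∘L A j - adjoint (B i) ∘L B j
        = P i ∘L (adjoint SA ∘L SA - adjoint SB ∘L SB) ∘L adjoint (P j) := by
          rw [← hA i, ← hA j, ← hB i, ← hB j]
          simp [adjoint_comp, comp_assoc, comp_sub, sub_comp]
      _ = P i ∘L adjoint S ∘L (∑ k, adjoint (P k) ∘L P k) ∘L S ∘L adjoint (P j) := by
          rw [hS, hP1]
          rfl
      _ = _ := by
          simp [Matrix.mul_apply, Matrix.star_apply, star_eq_adjoint, mul_def, comp_assoc,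
            adjoint_comp, finsetSum_comp, comp_finsetSum]

end

lemma norm_sum_adjoint_le_of_fin {n : ℕ} {𝒞 : Fin n → Set (G →L[ℂ] H)} {W : Fin n → H →L[ℂ] H}
    (hW : ∀ m : ℕ, 1 ≤ m → ∀ l : Fin m → Fin n, ∀ c : Fin m → (G →L[ℂ] H),
      (∀ j, c j ∈ 𝒞 (l j)) → ∀ h : Fin m → H,
      ‖∑ j, adjoint (c j) (adjoint (W (l j)) (h j))‖ ≤ ‖∑ j, adjoint (c j) (h j)‖)
    {α : Type*} (s : Finset α) (l : α → Fin n) (c : α → (G →L[ℂ] H)) (hc : ∀ a, c a ∈ 𝒞 (l a))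
    (h : α → H) :
    ‖∑ a ∈ s, adjoint (c a) (adjoint (W (l a)) (h a))‖ ≤ ‖∑ a ∈ s, adjoint (c a) (h a)‖ := by
  obtain rfl | hs := s.eq_empty_or_nonempty
  · simp
  let e := s.equivFin.symm
  have := hW s.card hs.card_pos (fun j => l (e j)) (fun j => c (e j)) (fun j => hc _)
    (fun j => h (e j))
  rwa [e.sum_comp (fun a : s => adjoint (c a) (adjoint (W (l a)) (h a))),
    e.sum_comp (fun a : s => adjoint (c a) (h a)),
    Finset.sum_coe_sort s (fun a => adjoint (c a) (adjoint (W (l a)) (h a))),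
    Finset.sum_coe_sort s (fun a => adjoint (c a) (h a))] at this

lemma exists_contraction_of_norm_sum_le {n : ℕ} {𝒞 : Fin n → Set (G →L[ℂ] H)}
    {W : Fin n → H →L[ℂ] H}
    (hW : ∀ m : ℕ, 1 ≤ m → ∀ l : Fin m → Fin n, ∀ c : Fin m → (G →L[ℂ] H),
      (∀ j, c j ∈ 𝒞 (l j)) → ∀ h : Fin m → H,
      ‖∑ j, adjoint (c j) (adjoint (W (l j)) (h j))‖ ≤ ‖∑ j, adjoint (c j) (h j)‖) :
    ∃ R : genSubspace 𝒞 →L[ℂ] G, ‖R‖ ≤ 1 ∧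
      ∀ (i : Fin n) (c : G →L[ℂ] H) (hc : c ∈ 𝒞 i) (h : H),
        R ⟨adjoint c h, Submodule.le_topologicalClosure _
            (Submodule.subset_span ⟨i, c, hc, h, rfl⟩)⟩ =
          adjoint c (adjoint (W i) h) := by
  let α := (Σ i, 𝒞 i) × H
  let g (a : α) : G := adjoint a.1.2.1 a.2
  have hg (a : α) : g a ∈ genSet 𝒞 := ⟨a.1.1, a.1.2.1, a.1.2.2, a.2, rfl⟩
  have range_g : Set.range g = genSet 𝒞 := by
    refine Set.Subset.antisymm (Set.range_subset_iff.mpr hg) ?_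
    rintro _ ⟨i, c, hc, h, rfl⟩
    exact ⟨(⟨i, c, hc⟩, h), rfl⟩
  let φ := Finsupp.linearCombination ℂ g
  let ψ := Finsupp.linearCombination ℂ fun a : α => adjoint a.1.2.1 (adjoint (W a.1.1) a.2)
  have range_φ : LinearMap.range φ = Submodule.span ℂ (genSet 𝒞) := by
    rw [Finsupp.range_linearCombination, range_g]
  have φ_mem (f : α →₀ ℂ) : φ f ∈ genSubspace 𝒞 :=
    Submodule.le_topologicalClosure _ (range_φ ▸ LinearMap.mem_range_self φ f)
  let e : (α →₀ ℂ) →ₗ[ℂ] genSubspace 𝒞 := φ.codRestrict _ φ_mem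
  have e_dense : DenseRange e := by
    intro x
    rw [closure_subtype]
    have : Subtype.val '' Set.range e = (Submodule.span ℂ (genSet 𝒞) : Set G) := by
      rw [← range_φ, ← Set.range_comp]
      rfl
    rw [this]
    exact x.2
  have bound (f : α →₀ ℂ) : ‖ψ f‖ ≤ 1 * ‖e f‖ := by
    rw [one_mul]
    simpa [e, φ, ψ, g, Finsupp.linearCombination_apply, Finsupp.sum] using
      norm_sum_adjoint_le_of_fin hW f.support (fun a => a.1.1) (fun a => a.1.2.1)
        (fun a => a.1.2.2) (fun a => f a • a.2)
  refine ⟨ψ.extendOfNorm e, LinearMap.opNorm_extendOfNorm_le e_dense zero_le_one bound,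
    fun i c hc h => ?_⟩
  have := LinearMap.extendOfNorm_eq e_dense ⟨1, bound⟩ (Finsupp.single (⟨i, c, hc⟩, h) 1)
  have he : e (Finsupp.single (⟨i, c, hc⟩, h) 1) = ⟨adjoint c h, Submodule.le_topologicalClosure _
      (Submodule.subset_span ⟨i, c, hc, h, rfl⟩)⟩ := by
    ext
    simp [e, φ, g]
  rw [← he, this]
  simp [ψ]

theorem contraction_on_span_iff_matrix_inequalities
    {n : ℕ} (hn : 1 ≤ n) (𝒞 : Fin n → Set (G →L[ℂ] H)) (W : Fin n → H →L[ℂ] H) :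
    ((∃ R : genSubspace 𝒞 →L[ℂ] G, ‖R‖ ≤ 1 ∧
        ∀ (i : Fin n) (c : G →L[ℂ] H) (hc : c ∈ 𝒞 i) (h : H),
          R ⟨ContinuousLinearMap.adjoint c h,
              Submodule.le_topologicalClosure _
                (Submodule.subset_span ⟨i, c, hc, h, rfl⟩)⟩ =
            ContinuousLinearMap.adjoint c (ContinuousLinearMap.adjoint (W i) h)) ↔
      (∀ m : ℕ, 1 ≤ m → ∀ l : Fin m → Fin n, ∀ c : Fin m → (G →L[ℂ] H),
        (∀ j, c j ∈ 𝒞 (l j)) →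
        StarLE
          (Matrix.of fun i j => W (l i) ∘L c i ∘L ContinuousLinearMap.adjoint (c j) ∘L
            ContinuousLinearMap.adjoint (W (l j)))
          (Matrix.of fun i j => c i ∘L ContinuousLinearMap.adjoint (c j)))) ∧
    ((∀ m : ℕ, 1 ≤ m → ∀ l : Fin m → Fin n, ∀ c : Fin m → (G →L[ℂ] H),
        (∀ j, c j ∈ 𝒞 (l j)) →
        StarLE
          (Matrix.of fun i j => W (l i) ∘L c i ∘L ContinuousLinearMap.adjoint (c j) ∘L
            ContinuousLinearMap.adjoint (W (l j)))
          (Matrix.of fun i j => c i ∘L ContinuousLinearMap.adjoint (c j))) ↔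
      (∀ m : ℕ, 1 ≤ m → ∀ l : Fin m → Fin n, ∀ c : Fin m → (G →L[ℂ] H),
        (∀ j, c j ∈ 𝒞 (l j)) → ∀ h : Fin m → H,
        ‖∑ j, ContinuousLinearMap.adjoint (c j)
            (ContinuousLinearMap.adjoint (W (l j)) (h j))‖ ≤
          ‖∑ j, ContinuousLinearMap.adjoint (c j) (h j)‖)) := by
  have gram : (∀ m : ℕ, 1 ≤ m → ∀ l : Fin m → Fin n, ∀ c : Fin m → (G →L[ℂ] H),
        (∀ j, c j ∈ 𝒞 (l j)) →
        StarLE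
          (Matrix.of fun i j => W (l i) ∘L c i ∘L adjoint (c j) ∘L adjoint (W (l j)))
          (Matrix.of fun i j => c i ∘L adjoint (c j))) ↔
      (∀ m : ℕ, 1 ≤ m → ∀ l : Fin m → Fin n, ∀ c : Fin m → (G →L[ℂ] H),
        (∀ j, c j ∈ 𝒞 (l j)) → ∀ h : Fin m → H,
        ‖∑ j, adjoint (c j) (adjoint (W (l j)) (h j))‖ ≤ ‖∑ j, adjoint (c j) (h j)‖) := by
    refine forall₅_congr fun m _ l c _ => ?_
    simpa [adjoint_comp, comp_assoc] using
      starLE_gram_iff (fun j => adjoint (c j)) (fun j => adjoint (c j) ∘L adjoint (W (l j)))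
  refine ⟨⟨?_, fun h => exists_contraction_of_norm_sum_le (gram.mp h)⟩, gram⟩
  rintro ⟨R, hR, hRc⟩
  refine gram.mpr fun m _ l c hc h => ?_
  simp_rw [← hRc _ _ (hc _), ← map_sum]
  refine (R.le_of_opNorm_le hR _).trans_eq ?_
  simp
end
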